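/- Let T > 0, L > 0, let s ∈ C¹[0,T] with 0 < s(t) ≤ L for all t ∈ [0,T), and let D(s) = {(x,t) ∈ ℝ² : 0 < x < s(t), 0 < t < T}. Let u be continuous on the closure of D(s) and satisfy the heat equation u_xx(x,t) = u_t(x,t) classically at every point of D(s) (the partial derivatives u_x, u_xx, u_t exist and are continuous in D(s)). Then for every compact set D_c ⊂ D(s) and every ε > 0 there exist N ∈ ℕ and real constants a_0, …, a_N such that max_{(x,t) ∈ D_c} |u(x,t) − Σ_{n=0}^{N} a_n h_n(x,t)| < ε, where h_n are the heat polynomials. -/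

import Mathlib

/-- The coefficient `c_k^n = n! / ((n - 2k)! k!)` of the heat polynomial. -/
noncomputable def heatCoeff (n k : ℕ) : ℝ :=
  (Nat.factorial n : ℝ) / ((Nat.factorial (n - 2 * k) : ℝ) * (Nat.factorial k : ℝ))

/-- The heat polynomial `h_n(x,t) = Σ_{k=0}^{⌊n/2⌋} c_k^n x^{n-2k} t^k`. -/
noncomputable def heatPoly (n : ℕ) (x t : ℝ) : ℝ :=
  ∑ k ∈ Finset.range (n / 2 + 1), heatCoeff n k * x ^ (n - 2 * k) * t ^ k

section HeatAux

open MeasureTheory Filter Topology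


/-- unnormalised heat kernel, complex space variable -/
noncomputable def hkC (w : ℂ) (s : ℝ) : ℂ :=
  (((√s)⁻¹ : ℝ) : ℂ) * Complex.exp (-w ^ 2 / (4 * s))

/-- unnormalised heat kernel -/
noncomputable def hk (a s : ℝ) : ℝ := (√s)⁻¹ * Real.exp (-a ^ 2 / (4 * s))

noncomputable def hkD (a s : ℝ) : ℝ := -(a / (2 * s)) * hk a s

noncomputable def hkDD (a s : ℝ) : ℝ := (a ^ 2 / (4 * s ^ 2) - 1 / (2 * s)) * hk a s

lemma hkC_ofReal (a s : ℝ) : hkC a s = (hk a s : ℂ) := by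
  simp [hkC, hk]

lemma hk_of_nonpos (a s : ℝ) (hs : s ≤ 0) : hk a s = 0 := by
  simp [hk, Real.sqrt_eq_zero_of_nonpos hs]

lemma hkC_of_nonpos (a : ℂ) (s : ℝ) (hs : s ≤ 0) : hkC a s = 0 := by
  simp [hkC, Real.sqrt_eq_zero_of_nonpos hs]

lemma hk_nonneg (a s : ℝ) : 0 ≤ hk a s := by unfold hk; positivity

lemma hk_neg (a s : ℝ) : hk (-a) s = hk a s := by simp [hk]

lemma norm_hkC (w : ℂ) (s : ℝ) : ‖hkC w s‖ = (√s)⁻¹ * Real.exp (-(w ^ 2).re / (4 * s)) := by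
  unfold hkC
  rw [norm_mul, Complex.norm_exp, Complex.norm_real, Real.norm_of_nonneg (by positivity)]
  congr 2
  have : (-w ^ 2 / (4 * (s : ℂ))) = (-w ^ 2) / ((4 * s : ℝ) : ℂ) := by push_cast; rfl
  rw [this, Complex.div_ofReal_re]
  simp

lemma pow_exp_bound (k : ℕ) (b s : ℝ) (hb : 0 < b) (hs : 0 < s) :
    (s⁻¹) ^ k * Real.exp (-b / s) ≤ k.factorial / b ^ k := by
  have h := Real.pow_div_factorial_le_exp (b / s) (by positivity) k
  have hk : (0 : ℝ) < k.factorial := by positivity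
  rw [neg_div, Real.exp_neg, ← div_eq_mul_inv, div_le_div_iff₀ (Real.exp_pos _) (by positivity)]
  rw [div_le_iff₀ hk] at h
  calc s⁻¹ ^ k * b ^ k = (b / s) ^ k := by rw [div_eq_mul_inv, mul_pow]; ring
    _ ≤ _ := by linarith

lemma sqrt_inv_le (s : ℝ) (hs : 0 < s) : (√s)⁻¹ ≤ 1 + s⁻¹ := by
  have h : s⁻¹ = (√s)⁻¹ ^ 2 := by rw [inv_pow, Real.sq_sqrt hs.le]
  rw [h]
  nlinarith [sq_nonneg ((√s)⁻¹ - 1), sq_nonneg ((√s)⁻¹)]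

lemma hk_bound (a0 : ℝ) (ha0 : 0 < a0) (k : ℕ) :
    ∃ C : ℝ, 0 ≤ C ∧ ∀ a s : ℝ, a0 ≤ |a| → 0 < s → (s⁻¹) ^ k * hk a s ≤ C := by
  refine ⟨k.factorial / (a0 ^ 2 / 4) ^ k + (k + 1).factorial / (a0 ^ 2 / 4) ^ (k + 1),
    by positivity, fun a s ha hs => ?_⟩
  have hb : 0 < a0 ^ 2 / 4 := by positivity
  have h1 := pow_exp_bound k _ s hb hs
  have h2 := pow_exp_bound (k + 1) _ s hb hs
  have h3 : Real.exp (-a ^ 2 / (4 * s)) ≤ Real.exp (-(a0 ^ 2 / 4) / s) := by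
    apply Real.exp_le_exp.2
    have : a0 ^ 2 ≤ a ^ 2 := by
      rw [← sq_abs a]; gcongr
    have e : -(a0 ^ 2 / 4) / s = -a0 ^ 2 / (4 * s) := by field_simp
    rw [e]
    gcongr
  calc s⁻¹ ^ k * hk a s ≤ s⁻¹ ^ k * ((1 + s⁻¹) * Real.exp (-(a0 ^ 2 / 4) / s)) := by
        unfold hk
        gcongr
        exact sqrt_inv_le s hs
    _ = s⁻¹ ^ k * Real.exp (-(a0 ^ 2 / 4) / s) + s⁻¹ ^ (k+1) * Real.exp (-(a0 ^ 2 / 4) / s) := by ring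
    _ ≤ _ := add_le_add h1 h2

lemma hkC_continuousAt (w : ℂ) (s : ℝ) (h : s ≠ 0 ∨ 0 < (w ^ 2).re) :
    ContinuousAt (fun q : ℂ × ℝ => hkC q.1 q.2) (w, s) := by
  rcases lt_trichotomy s 0 with hs | hs | hs
  · have : (fun q : ℂ × ℝ => hkC q.1 q.2) =ᶠ[𝓝 (w, s)] fun _ => 0 := by
      have : ∀ᶠ q : ℂ × ℝ in 𝓝 (w, s), q.2 < 0 :=
        continuous_snd.continuousAt.eventually (gt_mem_nhds hs)
      filter_upwards [this] with q hq
      exact hkC_of_nonpos _ _ hq.le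
    exact continuousAt_const.congr this.symm
  · subst hs
    have hm : 0 < (w ^ 2).re := by simpa using h
    set m := (w ^ 2).re
    have h1 : ∀ᶠ q : ℂ × ℝ in 𝓝 (w, 0), m / 2 < (q.1 ^ 2).re := by
      have : ContinuousAt (fun q : ℂ × ℝ => (q.1 ^ 2).re) (w, 0) := by fun_prop
      exact this.eventually (lt_mem_nhds (by show m / 2 < m; linarith))
    have h2 : Tendsto (fun q : ℂ × ℝ => √q.2 * (8 / m)) (𝓝 (w, 0)) (𝓝 0) := by
      have : ContinuousAt (fun q : ℂ × ℝ => √q.2 * (8 / m)) (w, 0) := by fun_prop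
      simpa [ContinuousAt] using this
    unfold ContinuousAt
    simp only [hkC_of_nonpos w 0 le_rfl]
    refine squeeze_zero_norm' ?_ h2
    filter_upwards [h1] with q hq
    rcases le_or_gt q.2 0 with h0 | h0
    · rw [hkC_of_nonpos _ _ h0]; simp; positivity
    · rw [norm_hkC]
      have e := pow_exp_bound 1 (m / 8) q.2 (by positivity) h0
      have : Real.exp (-(q.1 ^ 2).re / (4 * q.2)) ≤ Real.exp (-(m / 8) / q.2) := by
        apply Real.exp_le_exp.2
        have e : -(m / 8) / q.2 = -(m / 2) / (4 * q.2) := by field_simp; norm_num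
        rw [e]
        gcongr
      have e2 : (√q.2)⁻¹ = √q.2 * q.2⁻¹ := by
        have := Real.sq_sqrt h0.le
        have h5 : 0 < √q.2 := Real.sqrt_pos.2 h0
        field_simp
        linarith
      rw [e2, mul_assoc]
      gcongr
      calc q.2⁻¹ * Real.exp (-(q.1 ^ 2).re / (4 * q.2)) ≤ q.2⁻¹ * Real.exp (-(m / 8) / q.2) := by
            gcongr
        _ ≤ 8 / m := by simpa using e
  · have h3 : √s ≠ 0 := (Real.sqrt_pos.2 hs).ne'
    have h4 : (4 * s : ℂ) ≠ 0 := by simpa using hs.ne'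
    unfold hkC
    refine ContinuousAt.mul (Complex.continuous_ofReal.continuousAt.comp ?_) (ContinuousAt.cexp ?_)
    · exact ContinuousAt.inv₀ (by fun_prop) h3
    · exact ContinuousAt.div (by fun_prop) (by fun_prop) h4

lemma hk_continuousAt (a s : ℝ) (h : s ≠ 0 ∨ a ≠ 0) :
    ContinuousAt (fun q : ℝ × ℝ => hk q.1 q.2) (a, s) := by
  have h1 : ContinuousAt (fun q : ℝ × ℝ => hkC q.1 q.2) (a, s) := by
    have := hkC_continuousAt a s (h.imp id (fun h => by
      rw [← Complex.ofReal_pow, Complex.ofReal_re]; positivity))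
    have hc : Continuous (fun q : ℝ × ℝ => ((q.1 : ℂ), q.2)) :=
      (Complex.continuous_ofReal.comp continuous_fst).prodMk continuous_snd
    exact ContinuousAt.comp (f := fun q : ℝ × ℝ => ((q.1 : ℂ), q.2)) (x := (a, s)) this
      hc.continuousAt
  have h2 := Complex.continuous_re.continuousAt.comp h1
  convert h2 using 2 with q
  simp [hkC_ofReal]

lemma hkC_differentiable (s : ℝ) : Differentiable ℂ (fun w => hkC w s) := by
  unfold hkC
  fun_prop

lemma hk_hasDerivAt_a (a s : ℝ) (hs : 0 < s) : HasDerivAt (fun a => hk a s) (hkD a s) a := by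
  unfold hkD hk
  have h1 : HasDerivAt (fun a : ℝ => -a ^ 2 / (4 * s)) (-(2 * a) / (4 * s)) a := by
    have := ((hasDerivAt_pow 2 a).neg).div_const (4 * s)
    simpa using this
  refine (h1.exp.const_mul (√s)⁻¹).congr_deriv ?_
  field_simp
  ring

lemma hkD_hasDerivAt_a (a s : ℝ) (hs : 0 < s) : HasDerivAt (fun a => hkD a s) (hkDD a s) a := by
  unfold hkD
  have h1 : HasDerivAt (fun a : ℝ => -(a / (2 * s))) (-(1 / (2 * s))) a :=
    ((hasDerivAt_id a).div_const (2 * s)).neg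
  refine (h1.mul (hk_hasDerivAt_a a s hs)).congr_deriv ?_
  unfold hkDD hkD
  field_simp
  ring

lemma hk_hasDerivAt_s (a s : ℝ) (hs : 0 < s) : HasDerivAt (fun s => hk a s) (hkDD a s) s := by
  unfold hkDD hk
  have h5 : 0 < √s := Real.sqrt_pos.2 hs
  have h1 : HasDerivAt (fun s : ℝ => -a ^ 2 / (4 * s)) (a ^ 2 / (4 * s ^ 2)) s := by
    have := (((hasDerivAt_id s).const_mul 4).fun_inv (by simpa using hs.ne')).const_mul (-a ^ 2)
    refine this.congr_deriv ?_
    simp only [id]; field_simp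
  have h2 : HasDerivAt (fun s : ℝ => (√s)⁻¹) (-(1 / (2 * √s)) / (√s) ^ 2) s :=
    (Real.hasDerivAt_sqrt hs.ne').fun_inv h5.ne'
  refine (h2.mul h1.exp).congr_deriv ?_
  rw [Real.sq_sqrt hs.le]
  field_simp
  ring

lemma hk_exp_bound (a0 : ℝ) (ha0 : 0 < a0) :
    ∃ C : ℝ, 0 ≤ C ∧ (∀ a s : ℝ, a0 ≤ |a| → |hk a s| ≤ C) ∧
     (∀ a s : ℝ, a0 ≤ |a| → |a| ≤ 4 * a0 → 0 < s → |hkD a s| ≤ C) ∧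
     (∀ a s : ℝ, a0 ≤ |a| → |a| ≤ 4 * a0 → 0 < s → |hkDD a s| ≤ C) := by
  obtain ⟨C0, h0, H0⟩ := hk_bound a0 ha0 0
  obtain ⟨C1, h1, H1⟩ := hk_bound a0 ha0 1
  obtain ⟨C2, h2, H2⟩ := hk_bound a0 ha0 2
  refine ⟨C0 + (2 * a0 * C1 + C1) + 4 * a0 ^ 2 * C2, by positivity, ?_, ?_, ?_⟩
  · intro a s ha
    rcases le_or_gt s 0 with hs | hs
    · rw [hk_of_nonpos a s hs]; simp; positivity
    · rw [abs_of_nonneg (hk_nonneg _ _)]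
      have := H0 a s ha hs
      have : 0 ≤ (2 * a0 * C1 + C1) + 4 * a0 ^ 2 * C2 := by positivity
      simp at *; linarith
  · intro a s ha ha' hs
    have := H1 a s ha hs
    have h3 : |hkD a s| = |a| / 2 * (s⁻¹ ^ 1 * hk a s) := by
      unfold hkD
      rw [abs_mul, abs_neg, abs_div, abs_of_nonneg (hk_nonneg _ _), abs_of_pos (by positivity : 0 < 2 * s)]
      field_simp
    have h4 : |a| / 2 * (s⁻¹ ^ 1 * hk a s) ≤ (2 * a0) * C1 := by
      have := hk_nonneg a s
      gcongr
      linarith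
    have : 0 ≤ C0 + C1 + 4 * a0 ^ 2 * C2 := by positivity
    linarith
  · intro a s ha ha' hs
    have e1 := H1 a s ha hs
    have e2 := H2 a s ha hs
    have hn := hk_nonneg a s
    have h3 : hkDD a s = a ^ 2 / 4 * (s⁻¹ ^ 2 * hk a s) - 1 / 2 * (s⁻¹ ^ 1 * hk a s) := by
      unfold hkDD; field_simp
    have h4 : a ^ 2 / 4 * (s⁻¹ ^ 2 * hk a s) ≤ (4 * a0 ^ 2) * C2 := by
      gcongr
      have : a ^ 2 ≤ (4 * a0) ^ 2 := by rw [← sq_abs a]; gcongr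
      linarith
    have h5 : 0 ≤ a ^ 2 / 4 * (s⁻¹ ^ 2 * hk a s) := by positivity
    have h6 : 0 ≤ (s⁻¹ ^ 1 * hk a s) := by positivity
    have : 0 ≤ 2 * a0 * C1 := by positivity
    have : 0 ≤ 4 * a0 ^ 2 * C2 := by positivity
    rw [h3, abs_le]
    constructor <;> linarith


lemma measurable_hk (a : ℝ) : Measurable (fun s => hk a s) := by
  unfold hk; fun_prop

lemma measurable_hkD (a : ℝ) : Measurable (fun s => hkD a s) := by
  unfold hkD hk; fun_prop

lemma measurable_hkDD (a : ℝ) : Measurable (fun s => hkDD a s) := by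
  unfold hkDD hk; fun_prop

lemma integrable_exp_bdd (lam : ℂ) (hre : 0 < lam.re) (F : ℝ → ℝ) (hF : Measurable F) (C : ℝ)
    (hC : ∀ s, 0 < s → |F s| ≤ C) :
    IntegrableOn (fun s : ℝ => Complex.exp (-lam * s) * (F s : ℂ)) (Set.Ioi 0) := by
  have h := integrableOn_exp_mul_complex_Ioi (a := -lam) (by simpa using hre) 0
  refine Integrable.mul_bdd (c := C) h (by fun_prop) ?_
  filter_upwards [ae_restrict_mem measurableSet_Ioi] with s hs
  simpa using hC s hs

lemma deriv_laplace (lam : ℂ) (hre : 0 < lam.re) (F F' : ℝ → ℝ → ℝ)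
    (hF : ∀ a, Measurable (F a)) (hF' : ∀ a, Measurable (F' a))
    (hd : ∀ a s, 0 < s → HasDerivAt (fun a => F a s) (F' a s) a)
    (hb : ∀ a0, 0 < a0 → ∃ C : ℝ, ∀ a s : ℝ, a0 ≤ |a| → |a| ≤ 4 * a0 → 0 < s →
      |F a s| ≤ C ∧ |F' a s| ≤ C) (a : ℝ) (ha : 0 < a) :
    HasDerivAt (fun a => ∫ s in Set.Ioi (0:ℝ), Complex.exp (-lam * s) * (F a s : ℂ))
      (∫ s in Set.Ioi (0:ℝ), Complex.exp (-lam * s) * (F' a s : ℂ)) a := by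
  obtain ⟨C, hC⟩ := hb (a / 2) (by positivity)
  have h := integrableOn_exp_mul_complex_Ioi (a := -lam) (by simpa using hre) 0
  refine (hasDerivAt_integral_of_dominated_loc_of_deriv_le (E := ℂ) (𝕜 := ℝ) (x₀ := a)
    (F := fun a (s:ℝ) => Complex.exp (-lam * s) * (F a s : ℂ))
    (F' := fun a (s:ℝ) => Complex.exp (-lam * s) * (F' a s : ℂ))
    (bound := fun (s:ℝ) => ‖Complex.exp (-lam * s)‖ * C) (s := Set.Ioo (a / 2) (2 * a))
    (Ioo_mem_nhds (half_lt_self ha) (lt_two_mul_self ha)) ?_ ?_ ?_ ?_ ?_ ?_).2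
  · exact Eventually.of_forall fun x => by
      have := hF x
      fun_prop
  · refine integrable_exp_bdd lam hre _ (hF a) C fun s hs => (hC a s ?_ ?_ hs).1 <;>
    rw [abs_of_pos ha] <;> linarith
  · have := hF' a
    fun_prop
  · filter_upwards [ae_restrict_mem measurableSet_Ioi] with s hs x hx
    rw [norm_mul]
    gcongr
    have hx0 : 0 < x := by linarith [hx.1]
    have := (hC x s (by rw [abs_of_pos hx0]; exact hx.1.le)
      (by rw [abs_of_pos hx0]; linarith [hx.2]) hs).2
    simpa using this
  · exact h.norm.mul_const C
  · filter_upwards [ae_restrict_mem measurableSet_Ioi] with s hs x hx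
    exact ((hd x s hs).ofReal_comp).const_mul _

lemma laplace_parts (lam : ℂ) (hre : 0 < lam.re) (a : ℝ) (ha : 0 < a) :
    ∫ s in Set.Ioi (0:ℝ), Complex.exp (-lam * s) * (hkDD a s : ℂ) =
    lam * ∫ s in Set.Ioi (0:ℝ), Complex.exp (-lam * s) * (hk a s : ℂ) := by
  obtain ⟨C, hC0, h1, h2, h3⟩ := hk_exp_bound a ha
  have i1 := integrable_exp_bdd lam hre _ (measurable_hk a) C
    (fun s hs => h1 a s (le_abs_self a))
  have i2 := integrable_exp_bdd lam hre _ (measurable_hkDD a) C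
    (fun s hs => h3 a s (le_abs_self a) (by rw [abs_of_pos ha]; linarith) hs)
  have key := integral_Ioi_of_hasDerivAt_of_tendsto
    (f := fun s : ℝ => Complex.exp (-lam * s) * (hk a s : ℂ))
    (f' := fun s : ℝ => Complex.exp (-lam * s) * (hkDD a s : ℂ) -
      lam * (Complex.exp (-lam * s) * (hk a s : ℂ))) (a := 0) (m := 0) ?_ ?_ ?_ ?_
  · rw [integral_sub i2 (i1.const_mul lam), integral_const_mul] at key
    simp only [hk_of_nonpos a 0 le_rfl] at key
    simp only [Complex.ofReal_zero, mul_zero, sub_zero] at key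
    exact sub_eq_zero.1 key
  · apply ContinuousAt.continuousWithinAt
    have := hk_continuousAt a 0 (Or.inr ha.ne')
    have h5 : ContinuousAt (fun s => hk a s) 0 :=
      ContinuousAt.comp (f := fun s : ℝ => (a, s)) (x := 0) this (by fun_prop)
    refine ContinuousAt.mul ?_ (Complex.continuous_ofReal.continuousAt.comp h5)
    exact (Complex.continuous_exp.comp (continuous_const.mul Complex.continuous_ofReal)).continuousAt
  · intro s hs
    have e1 : HasDerivAt (fun s : ℝ => Complex.exp (-lam * s)) (Complex.exp (-lam * s) * (-lam)) s := by
      have : HasDerivAt (fun s : ℝ => -lam * (s:ℂ)) (-lam) s := by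
        simpa using (Complex.ofRealCLM.hasDerivAt (x := s)).const_mul (-lam)
      exact this.cexp
    refine (e1.mul (hk_hasDerivAt_s a s hs).ofReal_comp).congr_deriv ?_
    ring
  · exact i2.sub (i1.const_mul lam)
  · have : Tendsto (fun s : ℝ => Real.exp (-lam.re * s) * C) atTop (𝓝 0) := by
      have : Tendsto (fun s : ℝ => Real.exp (-(lam.re * s))) atTop (𝓝 0) :=
        Real.tendsto_exp_neg_atTop_nhds_zero.comp (tendsto_id.const_mul_atTop hre)
      simpa using this.mul_const C
    refine squeeze_zero_norm (fun s => ?_) this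
    rw [norm_mul, Complex.norm_exp]
    have e := h1 a s (le_abs_self a)
    have e2 : (-lam * (s:ℂ)).re = -lam.re * s := by simp
    rw [e2, Complex.norm_real, Real.norm_eq_abs]
    gcongr

lemma laplace_form (lam κ : ℂ) (hre : 0 < lam.re) (hκ : κ ^ 2 = lam) :
    ∃ A B : ℂ, ∀ a : ℝ, 0 < a → ∫ s in Set.Ioi (0:ℝ), Complex.exp (-lam * s) * (hk a s : ℂ) =
      A * Complex.exp (κ * a) + B * Complex.exp (-κ * a) := by
  set I0 : ℝ → ℂ := fun a => ∫ s in Set.Ioi (0:ℝ), Complex.exp (-lam * s) * (hk a s : ℂ) with hI0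
  set I1 : ℝ → ℂ := fun a => ∫ s in Set.Ioi (0:ℝ), Complex.exp (-lam * s) * (hkD a s : ℂ) with hI1
  have hκ0 : κ ≠ 0 := by
    rintro rfl
    simp at hκ; rw [← hκ] at hre; simp at hre
  have d0 : ∀ a, 0 < a → HasDerivAt I0 (I1 a) a := by
    intro a ha
    refine deriv_laplace lam hre hk hkD measurable_hk measurable_hkD hk_hasDerivAt_a ?_ a ha
    intro a0 ha0
    obtain ⟨C, hC0, h1, h2, h3⟩ := hk_exp_bound a0 ha0
    exact ⟨C, fun a s x1 x2 x3 => ⟨h1 a s x1, h2 a s x1 x2 x3⟩⟩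
  have d1 : ∀ a, 0 < a → HasDerivAt I1 (lam * I0 a) a := by
    intro a ha
    rw [hI0]
    simp only
    rw [← laplace_parts lam hre a ha]
    refine deriv_laplace lam hre hkD hkDD measurable_hkD measurable_hkDD hkD_hasDerivAt_a ?_ a ha
    intro a0 ha0
    obtain ⟨C, hC0, h1, h2, h3⟩ := hk_exp_bound a0 ha0
    exact ⟨C, fun a s x1 x2 x3 => ⟨h2 a s x1 x2 x3, h3 a s x1 x2 x3⟩⟩
  have key : ∀ μ : ℂ, μ ^ 2 = lam → ∃ c : ℂ, ∀ a : ℝ, 0 < a →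
      I1 a + μ * I0 a = c * Complex.exp (μ * a) := by
    intro μ hμ
    have hd : ∀ a : ℝ, 0 < a → HasDerivAt
        (fun a : ℝ => (I1 a + μ * I0 a) * Complex.exp (-μ * a)) 0 a := by
      intro a ha
      have e1 : HasDerivAt (fun s : ℝ => Complex.exp (-μ * s)) (Complex.exp (-μ * a) * (-μ)) a := by
        have : HasDerivAt (fun s : ℝ => -μ * (s:ℂ)) (-μ) a := by
          simpa using (Complex.ofRealCLM.hasDerivAt (x := a)).const_mul (-μ)
        exact this.cexp
      refine (((d1 a ha).add ((d0 a ha).const_mul μ)).mul e1).congr_deriv ?_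
      rw [← hμ]; simp only [Pi.add_apply]; ring
    refine ⟨(I1 1 + μ * I0 1) * Complex.exp (-μ * (1:ℝ)), fun a ha => ?_⟩
    have := isOpen_Ioi.is_const_of_deriv_eq_zero (s := Set.Ioi (0:ℝ)) isPreconnected_Ioi
      (fun a ha => (hd a ha).differentiableAt.differentiableWithinAt)
      (fun a ha => (hd a ha).deriv) (x := 1) (y := a) (by simp) ha
    rw [this, mul_assoc, ← Complex.exp_add]
    simp
  obtain ⟨c1, hc1⟩ := key κ hκ
  obtain ⟨c2, hc2⟩ := key (-κ) (by simpa using hκ)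
  refine ⟨c1 / (2 * κ), -c2 / (2 * κ), fun a ha => ?_⟩
  have e1 := hc1 a ha
  have e2 := hc2 a ha
  show I0 a = _
  rw [neg_mul] at e2 ⊢
  rw [neg_mul] at e2
  field_simp
  linear_combination e1 - e2


/-- exponential heat solution as an element of `C(K,ℂ)` -/
noncomputable def expMap (K : Set (ℝ × ℝ)) (z : ℂ) : C(K, ℂ) :=
  ⟨fun p => Complex.exp (z * (p.1.1 : ℂ) + z ^ 2 * (p.1.2 : ℂ)), by fun_prop⟩

/-- heat polynomial as an element of `C(K,ℂ)` -/
noncomputable def hpMap (K : Set (ℝ × ℝ)) (n : ℕ) : C(K, ℂ) :=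
  ⟨fun p => (heatPoly n p.1.1 p.1.2 : ℂ), by unfold heatPoly; fun_prop⟩

lemma expMap_ker {K : Set (ℝ × ℝ)} [CompactSpace K] {E : Type*} [NormedAddCommGroup E]
    [NormedSpace ℂ E] [CompleteSpace E] (l : C(K, ℂ) →L[ℂ] E) (hl : ∀ n, l (hpMap K n) = 0)
    (z : ℂ) : l (expMap K z) = 0 := by
  obtain ⟨X, hX⟩ : ∃ X : C(K, ℂ), ∀ p, X p = z * (p.1.1 : ℂ) :=
    ⟨⟨fun p => z * (p.1.1 : ℂ), by fun_prop⟩, fun p => rfl⟩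
  obtain ⟨Y, hY⟩ : ∃ Y : C(K, ℂ), ∀ p, Y p = z ^ 2 * (p.1.2 : ℂ) :=
    ⟨⟨fun p => z ^ 2 * (p.1.2 : ℂ), by fun_prop⟩, fun p => rfl⟩
  have sX := NormedSpace.norm_expSeries_summable' (𝕂 := ℂ) X
  have sY := NormedSpace.norm_expSeries_summable' (𝕂 := ℂ) Y
  have sXY := summable_mul_of_summable_norm sX sY
  have hev : ∀ (F : C(K, ℂ)) (p : K), HasSum (fun n : ℕ => (((n.factorial : ℂ)⁻¹ • F ^ n) : C(K, ℂ)) p)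
      (Complex.exp (F p)) := by
    intro F p
    have := NormedSpace.exp_series_hasSum_exp' (𝕂 := ℂ) (F p)
    rw [← Complex.exp_eq_exp_ℂ] at this
    simpa using this
  have hsum : (∑' x : ℕ × ℕ, (((x.1.factorial : ℂ)⁻¹ • X ^ x.1) * ((x.2.factorial : ℂ)⁻¹ • Y ^ x.2)))
      = expMap K z := by
    ext p
    have h1 := (ContinuousMap.evalCLM ℂ p).hasSum sXY.hasSum
    simp only [ContinuousMap.evalCLM_apply, ContinuousMap.mul_apply] at h1
    have hx := hev X p
    have hy := hev Y p
    have h2 := HasSum.mul hx hy h1.summable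
    have h3 := h1.unique h2
    rw [← Complex.exp_add, hX, hY] at h3
    rw [h3]
    rfl
  have hs := l.hasSum sXY.hasSum
  rw [hsum] at hs
  have hf := hs.tsum_fiberwise (fun x : ℕ × ℕ => x.1 + 2 * x.2)
  refine hf.unique ?_
  convert hasSum_zero using 2 with n
  set S : Finset (ℕ × ℕ) := (Finset.range (n / 2 + 1)).image (fun k => (n - 2 * k, k)) with hS
  have hset : (fun x : ℕ × ℕ => x.1 + 2 * x.2) ⁻¹' {n} = (S : Set (ℕ × ℕ)) := by
    ext ⟨j, k⟩
    simp only [hS, Set.mem_preimage, Set.mem_singleton_iff, Finset.coe_image, Set.mem_image,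
      Finset.coe_range, Set.mem_Iio, Prod.mk.injEq]
    constructor
    · intro h
      exact ⟨k, by omega, by omega, rfl⟩
    · rintro ⟨k', h1, h2, rfl⟩
      omega
  rw [hset, Finset.tsum_subtype' S (fun x => l (((x.1.factorial : ℂ)⁻¹ • X ^ x.1) * ((x.2.factorial : ℂ)⁻¹ • Y ^ x.2))),
    hS, Finset.sum_image (by intro a _ b _ h; exact (Prod.mk.inj h).2)]
  rw [← map_sum]
  have : (∑ k ∈ Finset.range (n / 2 + 1), (((n - 2 * k).factorial : ℂ)⁻¹ • X ^ (n - 2 * k)) *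
      ((k.factorial : ℂ)⁻¹ • Y ^ k)) = (z ^ n / (n.factorial : ℂ)) • hpMap K n := by
    ext p
    simp only [hpMap, heatPoly, heatCoeff, ContinuousMap.coe_sum, Finset.sum_apply,
      ContinuousMap.coe_mul, ContinuousMap.coe_smul, ContinuousMap.coe_pow, Pi.mul_apply,
      Pi.smul_apply, Pi.pow_apply, smul_eq_mul, hX, hY, ContinuousMap.coe_mk]
    push_cast
    rw [Finset.mul_sum]
    refine Finset.sum_congr rfl fun k hk => ?_
    have hk' : 2 * k ≤ n := by
      have := Finset.mem_range.1 hk; omega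
    have e : z ^ n = z ^ (n - 2 * k) * (z ^ 2) ^ k := by
      rw [← pow_mul, ← pow_add]; congr 1; omega
    have h1 : (n.factorial : ℂ) ≠ 0 := by exact_mod_cast n.factorial_ne_zero
    have h2 : ((n - 2 * k).factorial : ℂ) ≠ 0 := by exact_mod_cast (n - 2 * k).factorial_ne_zero
    have h3 : (k.factorial : ℂ) ≠ 0 := by exact_mod_cast k.factorial_ne_zero
    rw [e, mul_pow, mul_pow]
    field_simp
  rw [this, map_smul, hl, smul_zero]


open Classical in
/-- translated heat kernel as an element of `C(K,ℂ)` -/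
noncomputable def kern (K : Set (ℝ × ℝ)) (z : ℂ) (τ : ℝ) : C(K, ℂ) :=
  if h : Continuous (fun p : K => hkC ((p.1.1 : ℂ) - z) (p.1.2 - τ)) then ⟨_, h⟩ else 0

lemma kern_apply {K : Set (ℝ × ℝ)} {z : ℂ} {τ : ℝ}
    (h : ∀ p ∈ K, p.2 - τ ≠ 0 ∨ 0 < (((p.1 : ℂ) - z) ^ 2).re) (p : K) :
    kern K z τ p = hkC ((p.1.1 : ℂ) - z) (p.1.2 - τ) := by
  have hc : Continuous (fun p : K => hkC ((p.1.1 : ℂ) - z) (p.1.2 - τ)) := by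
    rw [continuous_iff_continuousAt]
    intro p
    have := hkC_continuousAt _ _ (h p.1 p.2)
    exact ContinuousAt.comp (f := fun p : K => (((p.1.1 : ℂ) - z), (p.1.2 - τ))) (x := p) this
      (by fun_prop)
  unfold kern
  rw [dif_pos hc]
  rfl

lemma kern_continuous {K : Set (ℝ × ℝ)} {Z : Type*} [TopologicalSpace Z] (z : Z → ℂ) (τ : Z → ℝ)
    (hz : Continuous z) (hτ : Continuous τ)
    (h : ∀ ζ, ∀ p ∈ K, p.2 - τ ζ ≠ 0 ∨ 0 < (((p.1 : ℂ) - z ζ) ^ 2).re) :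
    Continuous (fun ζ => kern K (z ζ) (τ ζ)) := by
  have hc : Continuous (fun q : Z × K => hkC ((q.2.1.1 : ℂ) - z q.1) (q.2.1.2 - τ q.1)) := by
    rw [continuous_iff_continuousAt]
    intro q
    have := hkC_continuousAt _ _ (h q.1 q.2.1 q.2.2)
    exact ContinuousAt.comp (f := fun q : Z × K => (((q.2.1.1 : ℂ) - z q.1), (q.2.1.2 - τ q.1)))
      (x := q) this (by fun_prop)
  have := (ContinuousMap.curry ⟨_, hc⟩).continuous
  convert this using 1
  ext ζ p
  rw [kern_apply (h ζ)]
  rfl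

lemma far_ker {K : Set (ℝ × ℝ)} [CompactSpace K] {E : Type*} [NormedAddCommGroup E]
    [NormedSpace ℂ E] [CompleteSpace E] (l : C(K, ℂ) →L[ℂ] E) (hl : ∀ n, l (hpMap K n) = 0)
    (sg a0 y T1 : ℝ) (hsg : sg = 1 ∨ sg = -1) (ha0 : 0 < a0)
    (hK : ∀ p ∈ K, a0 ≤ sg * (y - p.1)) (hT1 : ∀ p ∈ K, p.2 ≤ T1) (τ0 : ℝ) :
    l (kern K y τ0) = 0 := by
  have habs : ∀ p ∈ K, a0 ≤ |p.1 - y| := by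
    intro p hp
    have := hK p hp
    rcases hsg with rfl | rfl
    · rw [abs_sub_comm]; exact le_trans (by linarith) (le_abs_self _)
    · exact le_trans (by linarith) (le_abs_self _)
  have hsub : ∀ p ∈ K, ∀ s, hk (p.1 - y) s = hk (sg * (y - p.1)) s := by
    intro p hp s
    rcases hsg with rfl | rfl
    · rw [one_mul, ← hk_neg]; congr 1; ring
    · congr 1; ring
  have hcond : ∀ τ : ℝ, ∀ p ∈ K, p.2 - τ ≠ 0 ∨ 0 < (((p.1 : ℂ) - (y : ℂ)) ^ 2).re := by
    intro τ p hp
    right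
    rw [← Complex.ofReal_sub, ← Complex.ofReal_pow, Complex.ofReal_re]
    have := habs p hp
    have : p.1 - y ≠ 0 := by
      intro h; rw [h] at this; simp at this; linarith
    positivity
  have hker : ∀ τ (p : K), kern K y τ p = (hk (sg * (y - p.1.1)) (p.1.2 - τ) : ℂ) := by
    intro τ p
    rw [kern_apply (hcond τ), ← Complex.ofReal_sub, hkC_ofReal, hsub _ p.2]
  obtain ⟨C, hC0, hC, -, -⟩ := hk_exp_bound a0 ha0
  have hcont : Continuous (fun τ : ℝ => kern K y τ) :=
    kern_continuous (fun _ => (y : ℂ)) (fun τ => τ) (by fun_prop) (by fun_prop) hcond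
  set H : ℝ → C(K, ℂ) := fun τ => (Real.exp τ : ℂ) • kern K y τ with hH
  have hHc : Continuous H := by
    have h1 : Continuous (fun τ : ℝ => ((Real.exp τ : ℝ) : ℂ)) :=
      Complex.continuous_ofReal.comp Real.continuous_exp
    exact h1.smul hcont
  have hHb : ∀ τ, ‖H τ‖ ≤ (Set.Iic T1).indicator (fun τ => Real.exp τ * C) τ := by
    intro τ
    by_cases hτ : τ ≤ T1
    · rw [Set.indicator_of_mem (by exact hτ), hH]
      simp only [norm_smul, Complex.norm_real, Real.norm_eq_abs, Real.abs_exp]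
      gcongr
      rw [ContinuousMap.norm_le _ hC0]
      intro p
      rw [hker, Complex.norm_real]
      refine hC _ _ ?_
      exact le_trans (hK _ p.2) (le_abs_self _)
    · rw [Set.indicator_of_notMem (by exact hτ)]
      have : kern K y τ = 0 := by
        ext p
        rw [hker, hk_of_nonpos]
        · simp
        · have := hT1 _ p.2; push Not at hτ; linarith
      simp [hH, this]
  have hHi : Integrable H := by
    refine Integrable.mono' ?_ hHc.aestronglyMeasurable (Eventually.of_forall hHb)
    rw [integrable_indicator_iff measurableSet_Iic]
    exact (integrableOn_exp_Iic T1).mul_const C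
  have hF : FourierTransform.fourier (fun τ => l (H τ)) = 0 := by
    ext ω
    rw [Real.fourier_eq']
    have hi : Integrable (fun v : ℝ => Complex.exp (((-2 * Real.pi * inner ℝ v ω : ℝ) : ℂ) * Complex.I) • H v) := by
      refine (hHi.norm).mono' ?_ ?_
      · have h1 : Continuous (fun v : ℝ =>
            Complex.exp (((-2 * Real.pi * inner ℝ v ω : ℝ) : ℂ) * Complex.I)) := by
          refine Complex.continuous_exp.comp
            (Continuous.mul (Complex.continuous_ofReal.comp ?_) continuous_const)
          fun_prop
        exact (h1.smul hHc).aestronglyMeasurable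
      · refine Eventually.of_forall fun v => ?_
        rw [norm_smul, Complex.norm_exp_ofReal_mul_I, one_mul]
    have e1 : ∀ v : ℝ, Complex.exp (((-2 * Real.pi * inner ℝ v ω : ℝ) : ℂ) * Complex.I) • l (H v) =
      l (Complex.exp (((-2 * Real.pi * inner ℝ v ω : ℝ) : ℂ) * Complex.I) • H v) := by
      intro v; exact (l.map_smul _ _).symm
    simp_rw [e1]
    rw [l.integral_comp_comm hi]
    set lam : ℂ := 1 - 2 * Real.pi * ω * Complex.I with hlam
    have hre : 0 < lam.re := by simp [hlam]
    obtain ⟨κ, hκ⟩ := IsAlgClosed.exists_pow_nat_eq lam (n := 2) (by norm_num)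
    obtain ⟨A, B, hAB⟩ := laplace_form lam κ hre hκ
    have hsg2 : (sg : ℂ) ^ 2 = 1 := by rcases hsg with rfl | rfl <;> simp
    have hP : (∫ v : ℝ, Complex.exp (((-2 * Real.pi * inner ℝ v ω : ℝ) : ℂ) * Complex.I) • H v) =
        (A * Complex.exp (κ * sg * y)) • expMap K (-(κ * sg)) +
        (B * Complex.exp (-(κ * sg) * y)) • expMap K (κ * sg) := by
      ext p
      have h1 := (ContinuousMap.evalCLM ℂ p).integral_comp_comm hi
      simp only [ContinuousMap.evalCLM_apply] at h1
      rw [← h1]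
      have h2 : ∀ v : ℝ, (Complex.exp (((-2 * Real.pi * inner ℝ v ω : ℝ) : ℂ) * Complex.I) • H v) p =
         (fun s : ℝ => Complex.exp (lam * p.1.2) * (Complex.exp (-lam * s) * (hk (sg * (y - p.1.1)) s : ℂ))) (p.1.2 - v) := by
        intro v
        simp only [hH, ContinuousMap.smul_apply, smul_eq_mul, hker]
        rw [Complex.ofReal_exp, ← mul_assoc, ← mul_assoc, ← Complex.exp_add, ← Complex.exp_add]
        congr 2
        simp only [hlam, RCLike.inner_apply, conj_trivial]
        push_cast
        ring
      simp_rw [h2]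
      rw [integral_sub_left_eq_self (fun s : ℝ => Complex.exp (lam * p.1.2) * (Complex.exp (-lam * s) * (hk (sg * (y - p.1.1)) s : ℂ))) volume p.1.2]
      rw [integral_const_mul, ← setIntegral_eq_integral_of_forall_compl_eq_zero (s := Set.Ioi 0), hAB]
      · simp only [expMap, ContinuousMap.add_apply, ContinuousMap.smul_apply, ContinuousMap.coe_mk, smul_eq_mul]
        have q1 : (-(κ * sg)) ^ 2 = lam := by rw [neg_sq, mul_pow, hsg2, hκ, mul_one]
        have q2 : (κ * sg) ^ 2 = lam := by rw [mul_pow, hsg2, hκ, mul_one]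
        rw [q1, q2, mul_add, mul_left_comm, mul_left_comm _ B, ← Complex.exp_add, ← Complex.exp_add,
          mul_assoc A, mul_assoc B, ← Complex.exp_add, ← Complex.exp_add]
        congr 3 <;> push_cast <;> ring_nf
      · exact lt_of_lt_of_le ha0 (hK _ p.2)
      · intro s hs
        rw [hk_of_nonpos _ _ (not_lt.1 hs)]
        simp
    rw [hP, map_add, map_smul, map_smul, expMap_ker l hl, expMap_ker l hl]
    simp
  have hinv := Continuous.fourierInv_fourier_eq (f := fun τ => l (H τ)) (l.continuous.comp hHc)
    (l.integrable_comp hHi) (by rw [hF]; exact integrable_zero _ _ _)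
  have h0 : l (H τ0) = 0 := by
    have := congrFun hinv τ0
    rw [hF] at this
    rw [← this, Real.fourierInv_eq']
    simp
  simp only [hH, map_smul] at h0
  rcases smul_eq_zero.1 h0 with h | h
  · exact absurd h (by exact_mod_cast (Real.exp_pos τ0).ne')
  · exact h


lemma analytic_of_pointwise {K : Set (ℝ × ℝ)} [CompactSpace K] (F : ℂ → C(K, ℂ)) (c : ℂ) (r : ℝ)
    (hr : 0 < r) (hF : ContinuousOn F (Metric.closedBall c r))
    (hd : ∀ p, ∀ z ∈ Metric.ball c r, DifferentiableAt ℂ (fun z => F z p) z) :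
    AnalyticAt ℂ F c := by
  have hci : CircleIntegrable F c ((⟨r, hr.le⟩ : NNReal) : ℝ) :=
    (hF.mono Metric.sphere_subset_closedBall).circleIntegrable hr.le
  have h1 := hasFPowerSeriesOn_cauchy_integral hci hr
  refine (h1.analyticAt).congr ?_
  filter_upwards [Metric.ball_mem_nhds c hr] with w hw
  ext p
  have h2 := Complex.two_pi_I_inv_smul_circleIntegral_sub_inv_smul_of_differentiable_on_off_countable
    (s := ∅) (f := fun z => F z p) Set.countable_empty hw
    ((ContinuousMap.evalCLM ℂ p).continuous.comp_continuousOn hF) (fun x hx => hd p x hx.1)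
  rw [← h2]
  simp only [ContinuousMap.smul_apply]
  congr 1
  unfold circleIntegral
  have h3 : CircleIntegrable (fun z => (z - w)⁻¹ • F z) c r := by
    refine ContinuousOn.circleIntegrable hr.le ?_
    have h5 : ContinuousOn (fun z : ℂ => z - w) (Metric.sphere c r) := by fun_prop
    refine ContinuousOn.smul (ContinuousOn.inv₀ h5 ?_) (hF.mono Metric.sphere_subset_closedBall)
    intro z hz h
    rw [sub_eq_zero] at h
    subst h
    rw [Metric.mem_sphere] at hz
    rw [Metric.mem_ball] at hw
    linarith
  have h4 := (ContinuousMap.evalCLM ℂ p).intervalIntegral_comp_comm h3.out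
  simp only [ContinuousMap.evalCLM_apply] at h4
  exact h4.symm

lemma kern_cond_local {K : Set (ℝ × ℝ)} (hK : IsClosed K) (y τ : ℝ) (h : (y, τ) ∉ K) :
    ∃ ρ > 0, ∀ z ∈ Metric.closedBall (y : ℂ) ρ, ∀ p ∈ K,
      p.2 - τ ≠ 0 ∨ 0 < (((p.1 : ℂ) - z) ^ 2).re := by
  obtain ⟨ε, hε, hb⟩ := Metric.isOpen_iff.1 hK.isOpen_compl (y, τ) h
  refine ⟨ε / 4, by positivity, fun z hz p hp => ?_⟩
  by_cases hτ : p.2 - τ = 0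
  · right
    have hp' : ε ≤ |p.1 - y| := by
      by_contra hlt
      push Not at hlt
      refine hb ?_ hp
      rw [Metric.mem_ball, Prod.dist_eq]
      refine max_lt ?_ ?_
      · rwa [Real.dist_eq]
      · rw [Real.dist_eq, hτ]; simpa using hε
    rw [Metric.mem_closedBall, Complex.dist_eq] at hz
    have h1 := (Complex.abs_re_le_norm (z - y)).trans hz
    have h2 := (Complex.abs_im_le_norm (z - y)).trans hz
    simp only [Complex.sub_re, Complex.sub_im, Complex.ofReal_re, Complex.ofReal_im, sub_zero] at h1 h2
    have e : (((p.1 : ℂ) - z) ^ 2).re = (p.1 - z.re) ^ 2 - z.im ^ 2 := by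
      rw [pow_two, Complex.mul_re]; simp; ring
    rw [e]
    have h3 : ε * (3/4) ≤ |p.1 - z.re| := by
      have : |p.1 - y| ≤ |p.1 - z.re| + |z.re - y| := abs_sub_le _ _ _
      linarith
    have h4 : (ε * (3/4)) ^ 2 ≤ (p.1 - z.re) ^ 2 := by
      rw [← sq_abs (p.1 - z.re)]; gcongr
    have h5 : z.im ^ 2 ≤ (ε / 4) ^ 2 := by
      rw [← sq_abs z.im]; gcongr
    nlinarith
  · exact Or.inl hτ

lemma kern_analyticAt {K : Set (ℝ × ℝ)} [CompactSpace K] (hK : IsClosed K) (y τ : ℝ)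
    (h : (y, τ) ∉ K) : AnalyticAt ℂ (fun z => kern K z τ) (y : ℂ) := by
  obtain ⟨ρ, hρ, H⟩ := kern_cond_local hK y τ h
  refine analytic_of_pointwise _ _ ρ hρ ?_ ?_
  · rw [continuousOn_iff_continuous_domRestrict]
    exact kern_continuous (fun z : Metric.closedBall (y : ℂ) ρ => (z : ℂ)) (fun _ => τ)
      (by fun_prop) (by fun_prop) (fun z => H z z.2)
  · intro p z hz
    have h1 : DifferentiableAt ℂ (fun z : ℂ => hkC ((p.1.1 : ℂ) - z) (p.1.2 - τ)) z :=
      DifferentiableAt.comp (f := fun z : ℂ => (p.1.1 : ℂ) - z) (g := fun w => hkC w (p.1.2 - τ)) z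
        (hkC_differentiable _ _) (by fun_prop)
    refine h1.congr_of_eventuallyEq ?_
    filter_upwards [Metric.isOpen_ball.mem_nhds hz] with w hw
    exact kern_apply (H w (Metric.ball_subset_closedBall hw)) p

lemma push_ker {K : Set (ℝ × ℝ)} (hKc : IsCompact K) [CompactSpace K] {E : Type*}
    [NormedAddCommGroup E]
    [NormedSpace ℂ E] [CompleteSpace E] (l : C(K, ℂ) →L[ℂ] E) (hl : ∀ n, l (hpMap K n) = 0)
    (sg y τ : ℝ) (hsg : sg = 1 ∨ sg = -1) (hray : ∀ r, 0 ≤ r → (y + sg * r, τ) ∉ K) :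
    l (kern K y τ) = 0 := by
  obtain ⟨R, hR⟩ := hKc.isBounded.exists_norm_le
  set f : ℝ → E := fun r => l (kern K ((y + sg * r : ℝ) : ℂ) τ) with hf
  have hfa : AnalyticOnNhd ℝ f (Set.Ici 0) := by
    intro r hr
    have h1 := kern_analyticAt hKc.isClosed _ τ (hray r hr)
    have h2 : AnalyticAt ℂ (fun z => l (kern K z τ)) ((y + sg * r : ℝ) : ℂ) :=
      (l.analyticAt _).comp h1
    have h3 := h2.restrictScalars (𝕜 := ℝ)
    have h5 : AnalyticAt ℝ (fun r : ℝ => y + sg * r) r := by fun_prop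
    have h4 : AnalyticAt ℝ (fun r : ℝ => ((y + sg * r : ℝ) : ℂ)) r :=
      (Complex.ofRealCLM.analyticAt _).comp h5
    exact h3.comp_of_eq h4 rfl
  have hR0 : ∀ p ∈ K, |p.1| ≤ R ∧ |p.2| ≤ R := by
    intro p hp
    have := hR p hp
    rw [Prod.norm_def] at this
    exact ⟨(le_max_left _ _).trans this, (le_max_right _ _).trans this⟩
  have hsq : sg * sg = 1 := by rcases hsg with rfl | rfl <;> norm_num
  set r0 := |R| + |y| + 2
  have hev : f =ᶠ[𝓝 r0] 0 := by
    filter_upwards [lt_mem_nhds (show r0 - 1 < r0 by linarith)] with r hr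
    refine far_ker l hl sg 1 (y + sg * r) R hsg one_pos ?_ ?_ τ
    · intro p hp
      have e : sg * (y + sg * r - p.1) = sg * y + r - sg * p.1 := by linear_combination r * hsq
      rw [e]
      have h1 := (hR0 p hp).1
      have h2 := le_abs_self R
      have h3 := abs_le.1 h1
      have h4 := abs_le.1 (le_refl |y|)
      rcases hsg with rfl | rfl <;> simp only [r0] at hr <;> linarith
    · intro p hp
      exact (le_abs_self _).trans (hR0 p hp).2
  have := hfa.eqOn_zero_of_preconnected_of_eventuallyEq_zero isPreconnected_Ici
    (show r0 ∈ Set.Ici 0 by simp only [r0, Set.mem_Ici]; positivity) hev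
  have h0 := this (show (0:ℝ) ∈ Set.Ici 0 by simp)
  simpa [hf] using h0


lemma integrable_of_cont_bdd_supp (g : ℝ → ℝ) (hg : Continuous g) (R : ℝ)
    (h : ∀ y, R < |y| → g y = 0) : Integrable g := by
  refine hg.integrable_of_hasCompactSupport (HasCompactSupport.intro (isCompact_Icc (a := -R) (b := R)) ?_)
  intro y hy
  apply h
  by_contra hc
  push Not at hc
  exact hy (abs_le.1 hc)

lemma hk_continuous_a (x s : ℝ) (hs : 0 < s) : Continuous (fun y => hk (x - y) s) := by
  unfold hk
  fun_prop

lemma hkDD_continuous_a (x s : ℝ) (hs : 0 < s) : Continuous (fun y => hkDD (x - y) s) := by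
  unfold hkDD hk
  fun_prop

lemma J_hasDerivAt (v vx vxx vt : ℝ × ℝ → ℝ) (hv : Continuous v) (hvx : Continuous vx)
    (hvxx : Continuous vxx) (hvt : Continuous vt) (R : ℝ)
    (hR : ∀ q : ℝ × ℝ, R < |q.1| → v q = 0 ∧ vx q = 0 ∧ vxx q = 0 ∧ vt q = 0)
    (dx : ∀ p : ℝ × ℝ, HasDerivAt (fun x => v (x, p.2)) (vx p) p.1)
    (dxx : ∀ p : ℝ × ℝ, HasDerivAt (fun x => vx (x, p.2)) (vxx p) p.1)
    (dt : ∀ p : ℝ × ℝ, HasDerivAt (fun t => v (p.1, t)) (vt p) p.2)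
    (x t σ : ℝ) (hσ : 0 < σ) :
    HasDerivAt (fun σ => ∫ y, v (y, t - σ) * hk (x - y) σ)
      (-∫ y, (vt (y, t - σ) - vxx (y, t - σ)) * hk (x - y) σ) σ := by
  set D : ℝ → ℝ → ℝ := fun σ y => -vt (y, t - σ) * hk (x - y) σ + v (y, t - σ) * hkDD (x - y) σ
    with hD
  have hsub : ∀ s : ℝ, Continuous (fun y : ℝ => (y, t - s)) := fun s => by fun_prop
  have ihk : ∀ w : ℝ × ℝ → ℝ, Continuous w → (∀ q : ℝ × ℝ, R < |q.1| → w q = 0) → ∀ s, 0 < s →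
      Integrable (fun y => w (y, t - s) * hk (x - y) s) := by
    intro w hw hw0 s hs
    refine integrable_of_cont_bdd_supp _ ((hw.comp (hsub s)).mul (hk_continuous_a x s hs)) R ?_
    intro y hy
    rw [hw0 (y, t - s) hy, zero_mul]
  have ihkDD : Integrable (fun y => v (y, t - σ) * hkDD (x - y) σ) := by
    refine integrable_of_cont_bdd_supp _ ((hv.comp (hsub σ)).mul (hkDD_continuous_a x σ hσ)) R ?_
    intro y hy
    rw [(hR (y, t - σ) hy).1, zero_mul]
  have i1 := ihk v hv (fun q hq => (hR q hq).1) σ hσ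
  have i2 := ihk vxx hvxx (fun q hq => (hR q hq).2.2.1) σ hσ
  have i3 := ihk vt hvt (fun q hq => (hR q hq).2.2.2) σ hσ
  have iD : Integrable (D σ) := by
    have := i3.neg.add ihkDD
    refine this.congr (Eventually.of_forall fun y => ?_)
    simp [hD]
  -- integration by parts
  have hparts : ∫ y, (v (y, t - σ) * hkDD (x - y) σ - vxx (y, t - σ) * hk (x - y) σ) = 0 := by
    refine integral_eq_zero_of_hasDerivAt_of_integrable
      (f := fun y => v (y, t - σ) * (-hkD (x - y) σ) - vx (y, t - σ) * hk (x - y) σ) ?_ ?_ ?_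
    · intro y
      have e0 : HasDerivAt (fun y : ℝ => x - y) (-1) y := by
        simpa using (hasDerivAt_id y).const_sub x
      have e1 : HasDerivAt (fun y => hk (x - y) σ) (hkD (x - y) σ * (-1)) y :=
        (hk_hasDerivAt_a (x - y) σ hσ).comp y e0
      have e2 : HasDerivAt (fun y => hkD (x - y) σ) (hkDD (x - y) σ * (-1)) y :=
        (hkD_hasDerivAt_a (x - y) σ hσ).comp y e0
      refine (((dx (y, t - σ)).mul e2.neg).sub ((dxx (y, t - σ)).mul e1)).congr_deriv ?_
      simp only [Pi.neg_apply]
      ring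
    · exact ihkDD.sub i2
    · refine Integrable.sub ?_ (ihk vx hvx (fun q hq => (hR q hq).2.1) σ hσ)
      have hc : Continuous (fun y => hkD (x - y) σ) := by unfold hkD hk; fun_prop
      refine integrable_of_cont_bdd_supp _ ((hv.comp (hsub σ)).mul hc.neg) R ?_
      intro y hy
      rw [(hR (y, t - σ) hy).1, zero_mul]
  have hval : ∫ y, D σ y = -∫ y, (vt (y, t - σ) - vxx (y, t - σ)) * hk (x - y) σ := by
    have : ∀ y, D σ y = (v (y, t - σ) * hkDD (x - y) σ - vxx (y, t - σ) * hk (x - y) σ) -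
      (vt (y, t - σ) - vxx (y, t - σ)) * hk (x - y) σ := by intro y; simp only [hD]; ring
    simp_rw [this]
    have i4 : Integrable (fun y => v (y, t - σ) * hkDD (x - y) σ - vxx (y, t - σ) * hk (x - y) σ) :=
      ihkDD.sub i2
    rw [integral_sub i4, hparts, zero_sub]
    refine (i3.sub i2).congr (Eventually.of_forall fun y => ?_)
    simp only [Pi.sub_apply]; ring
  rw [← hval]
  -- bound
  have hcD : ContinuousOn (fun z : ℝ × ℝ => D z.1 z.2) (Set.Icc (σ / 2) (2 * σ) ×ˢ Set.Icc (-R) R) := by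
    intro z hz
    have hz1 : 0 < z.1 := lt_of_lt_of_le (by positivity) hz.1.1
    have hc : ContinuousAt (fun z : ℝ × ℝ => hk (x - z.2) z.1) z := by
      have := hk_continuousAt (x - z.2) z.1 (Or.inl hz1.ne')
      exact ContinuousAt.comp (f := fun z : ℝ × ℝ => (x - z.2, z.1)) (x := z) this (by fun_prop)
    have h1 : z.1 ≠ 0 := hz1.ne'
    have hc2 : ContinuousAt (fun z : ℝ × ℝ => hkDD (x - z.2) z.1) z := by
      unfold hkDD
      refine ContinuousAt.mul (ContinuousAt.sub ?_ ?_) hc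
      · exact ContinuousAt.div (by fun_prop) (by fun_prop) (by positivity)
      · exact ContinuousAt.div (by fun_prop) (by fun_prop) (by positivity)
    have hm : Continuous (fun z : ℝ × ℝ => (z.2, t - z.1)) := by fun_prop
    exact ((((hvt.comp hm).neg.continuousAt).mul hc).add
      ((hv.comp hm).continuousAt.mul hc2)).continuousWithinAt
  obtain ⟨M, hM⟩ := (isCompact_Icc.prod isCompact_Icc).exists_bound_of_continuousOn hcD
  refine (hasDerivAt_integral_of_dominated_loc_of_deriv_le (E := ℝ) (𝕜 := ℝ) (x₀ := σ)
    (F := fun σ y => v (y, t - σ) * hk (x - y) σ) (F' := D)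
    (bound := (Set.Icc (-R) R).indicator fun _ => M) (s := Set.Ioo (σ / 2) (2 * σ))
    (Ioo_mem_nhds (half_lt_self hσ) (lt_two_mul_self hσ)) ?_ i1 iD.aestronglyMeasurable ?_ ?_ ?_).2
  · filter_upwards [lt_mem_nhds hσ] with s hs
    exact (ihk v hv (fun q hq => (hR q hq).1) s hs).aestronglyMeasurable
  · refine Eventually.of_forall fun y s hs => ?_
    by_cases hy : y ∈ Set.Icc (-R) R
    · rw [Set.indicator_of_mem hy]
      exact hM (s, y) ⟨⟨hs.1.le, hs.2.le⟩, hy⟩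
    · rw [Set.indicator_of_notMem hy]
      have : R < |y| := by
        by_contra hc
        push Not at hc
        exact hy (abs_le.1 hc)
      have h2 := hR (y, t - s) this
      simp [hD, h2.1, h2.2.2.2]
  · rw [integrable_indicator_iff measurableSet_Icc]
    exact integrableOn_const (by simp)
  · refine Eventually.of_forall fun y s hs => ?_
    have hs0 : 0 < s := lt_trans (by positivity) hs.1
    have e0 : HasDerivAt (fun s : ℝ => t - s) (-1) s := by
      simpa using (hasDerivAt_id s).const_sub t
    have e1 : HasDerivAt (fun s => v (y, t - s)) (vt (y, t - s) * (-1)) s :=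
      HasDerivAt.comp (h₂ := fun τ => v (y, τ)) s (dt (y, t - s)) e0
    refine (e1.mul (hk_hasDerivAt_s (x - y) s hs0)).congr_deriv ?_
    simp only [hD]; ring

lemma J_subst (v : ℝ × ℝ → ℝ) (x t σ : ℝ) (hσ : 0 < σ) :
    ∫ y, v (y, t - σ) * hk (x - y) σ =
      ∫ r : ℝ, v (x + √σ * r, t - σ) * Real.exp (-(1/4) * r ^ 2) := by
  have hs : 0 < √σ := Real.sqrt_pos.2 hσ
  have h1 := Measure.integral_comp_mul_left
    (fun y => v (x + y, t - σ) * Real.exp (-y ^ 2 / (4 * σ))) (√σ)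
  have h2 : ∀ r : ℝ, v (x + √σ * r, t - σ) * Real.exp (-(1/4) * r ^ 2) =
      (fun y => v (x + y, t - σ) * Real.exp (-y ^ 2 / (4 * σ))) (√σ * r) := by
    intro r
    simp only [mul_pow, Real.sq_sqrt hσ.le]
    congr 2
    field_simp
  simp_rw [h2]
  rw [h1, ← integral_add_left_eq_self (fun y => v (y, t - σ) * hk (x - y) σ) x, ← integral_smul]
  congr 1
  ext y
  rw [abs_of_pos (by positivity), smul_eq_mul]
  unfold hk
  have : x - (x + y) = - y := by ring
  rw [this, neg_sq]
  ring

lemma representation (v vx vxx vt : ℝ × ℝ → ℝ) (hv : Continuous v) (hvx : Continuous vx)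
    (hvxx : Continuous vxx) (hvt : Continuous vt) (R : ℝ)
    (hR : ∀ q : ℝ × ℝ, R < |q.1| → v q = 0 ∧ vx q = 0 ∧ vxx q = 0 ∧ vt q = 0)
    (hR2 : ∀ q : ℝ × ℝ, R < |q.2| → v q = 0)
    (dx : ∀ p : ℝ × ℝ, HasDerivAt (fun x => v (x, p.2)) (vx p) p.1)
    (dxx : ∀ p : ℝ × ℝ, HasDerivAt (fun x => vx (x, p.2)) (vxx p) p.1)
    (dt : ∀ p : ℝ × ℝ, HasDerivAt (fun t => v (p.1, t)) (vt p) p.2)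
    (x t : ℝ)
    (hinteg : Integrable (fun q : ℝ × ℝ => (vt q - vxx q) * hk (x - q.1) (t - q.2))) :
    ∫ q : ℝ × ℝ, (vt q - vxx q) * hk (x - q.1) (t - q.2) = √(4 * Real.pi) * v (x, t) := by
  set m : ℝ → ℝ := fun σ => ∫ y, (vt (y, t - σ) - vxx (y, t - σ)) * hk (x - y) σ with hm
  rw [Measure.volume_eq_prod] at hinteg
  have h1 : ∀ τ : ℝ, (∫ y, (vt (y, τ) - vxx (y, τ)) * hk (x - y) (t - τ)) = m (t - τ) := by
    intro τ
    simp [hm]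
  have h2 : Integrable m := by
    have := hinteg.integral_prod_right
    simp only [h1] at this
    have := this.comp_sub_left t
    simpa using this
  rw [Measure.volume_eq_prod, integral_prod_symm _ hinteg]
  simp only [h1]
  rw [integral_sub_left_eq_self m volume t,
    ← setIntegral_eq_integral_of_forall_compl_eq_zero (s := Set.Ioi 0)]
  swap
  · intro σ hσ
    simp [hm, hk_of_nonpos _ _ (not_lt.1 hσ)]
  set J : ℝ → ℝ := fun σ => ∫ r : ℝ, v (x + √σ * r, t - σ) * Real.exp (-(1/4) * r ^ 2) with hJ
  have hgi : Integrable (fun r : ℝ => Real.exp (-(1/4) * r ^ 2)) :=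
    integrable_exp_neg_mul_sq (by norm_num)
  obtain ⟨M, hM⟩ : ∃ M, ∀ q, ‖v q‖ ≤ M := by
    refine hv.bounded_above_of_compact_support
      (HasCompactSupport.intro ((isCompact_Icc (a := -R) (b := R)).prod (isCompact_Icc (a := -R) (b := R))) ?_)
    intro q hq
    by_cases h1 : R < |q.1|
    · exact (hR q h1).1
    · by_cases h2 : R < |q.2|
      · exact hR2 q h2
      · push Not at h1 h2
        exact absurd ⟨abs_le.1 h1, abs_le.1 h2⟩ hq
  have hJc : Continuous J := by
    refine continuous_of_dominated (bound := fun r : ℝ => M * Real.exp (-(1/4) * r ^ 2)) ?_ ?_ ?_ ?_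
    · intro σ
      refine Continuous.aestronglyMeasurable ?_
      fun_prop
    · intro σ
      refine Eventually.of_forall fun r => ?_
      rw [norm_mul, Real.norm_eq_abs (Real.exp _), Real.abs_exp]
      gcongr
      exact hM _
    · exact hgi.const_mul M
    · refine Eventually.of_forall fun r => ?_
      fun_prop
  have key := integral_Ioi_of_hasDerivAt_of_tendsto (f := J) (f' := fun σ => -m σ) (a := 0) (m := 0)
    hJc.continuousWithinAt ?_ h2.neg.integrableOn ?_
  · rw [integral_neg] at key
    have hJ0 : J 0 = √(4 * Real.pi) * v (x, t) := by
      simp only [hJ, Real.sqrt_zero, zero_mul, add_zero, sub_zero]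
      rw [integral_const_mul, integral_gaussian, mul_comm]
      congr 2
      ring
    rw [← hJ0]; linarith
  · intro σ hσ
    have := J_hasDerivAt v vx vxx vt hv hvx hvxx hvt R hR dx dxx dt x t σ hσ
    refine this.congr_of_eventuallyEq ?_
    filter_upwards [lt_mem_nhds hσ] with s hs
    exact (J_subst v x t s hs).symm
  · refine tendsto_const_nhds.congr' ?_
    filter_upwards [eventually_gt_atTop (|t| + |R|)] with σ hσ
    have : ∀ r : ℝ, v (x + √σ * r, t - σ) = 0 := by
      intro r
      apply hR2
      have h1 := le_abs_self R
      have h2 := le_abs_self t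
      have h3 := neg_abs_le (t - σ)
      simp only
      linarith
    simp [hJ, this]


lemma cutoff_fun (δ : ℝ) (hδ : 0 < δ) : ∃ α α1 α2 : ℝ → ℝ, Continuous α ∧ Continuous α1 ∧
    Continuous α2 ∧ (∀ r, HasDerivAt α (α1 r) r) ∧ (∀ r, HasDerivAt α1 (α2 r) r) ∧
    (∀ r, r < δ → α r = 0 ∧ α1 r = 0 ∧ α2 r = 0) ∧ (∀ r, 2 * δ ≤ r → α r = 1) ∧
    (∀ r, 2 * δ < r → α1 r = 0 ∧ α2 r = 0) := by
  set α : ℝ → ℝ := fun r => Real.smoothTransition (r / δ - 1) with hα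
  have hc : ContDiff ℝ 2 α := by
    have h : ContDiff ℝ 2 Real.smoothTransition := Real.smoothTransition.contDiff (n := 2)
    exact h.comp (by fun_prop)
  have hc1 : ContDiff ℝ 1 (deriv α) := by
    have := (contDiff_succ_iff_deriv (n := 1) (f := α) (𝕜 := ℝ)).1 (by simpa [one_add_one_eq_two] using hc)
    exact this.2.2
  have hc2 : Continuous (deriv (deriv α)) := hc1.continuous_deriv le_rfl
  have z : ∀ r, r < δ → α r = 0 := by
    intro r hr
    apply Real.smoothTransition.zero_of_nonpos
    rw [sub_nonpos, div_le_one hδ]; exact hr.le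
  have o : ∀ r, 2 * δ ≤ r → α r = 1 := by
    intro r hr
    apply Real.smoothTransition.one_of_one_le
    rw [le_sub_iff_add_le, le_div_iff₀ hδ]; linarith
  have z1 : ∀ r, r < δ → deriv α r = 0 := by
    intro r hr
    have : α =ᶠ[𝓝 r] fun _ => 0 := by
      filter_upwards [gt_mem_nhds hr] with y hy using z y hy
    rw [this.deriv_eq]; simp
  have o1 : ∀ r, 2 * δ < r → deriv α r = 0 := by
    intro r hr
    have : α =ᶠ[𝓝 r] fun _ => 1 := by
      filter_upwards [lt_mem_nhds hr] with y hy using o y hy.le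
    rw [this.deriv_eq]; simp
  have z2 : ∀ r, r < δ → deriv (deriv α) r = 0 := by
    intro r hr
    have : deriv α =ᶠ[𝓝 r] fun _ => 0 := by
      filter_upwards [gt_mem_nhds hr] with y hy using z1 y hy
    rw [this.deriv_eq]; simp
  have o2 : ∀ r, 2 * δ < r → deriv (deriv α) r = 0 := by
    intro r hr
    have : deriv α =ᶠ[𝓝 r] fun _ => 0 := by
      filter_upwards [lt_mem_nhds hr] with y hy using o1 y hy
    rw [this.deriv_eq]; simp
  exact ⟨α, deriv α, deriv (deriv α), hc.continuous, hc1.continuous, hc2,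
    fun r => (hc.differentiable (by norm_num) r).hasDerivAt,
    fun r => (hc1.differentiable (by norm_num) r).hasDerivAt,
    fun r hr => ⟨z r hr, z1 r hr, z2 r hr⟩, o, fun r hr => ⟨o1 r hr, o2 r hr⟩⟩

lemma glue_zero {X : Type*} [TopologicalSpace X] {D C : Set X} (hC : IsClosed C) (g : X → ℝ)
    (h0 : ∀ q ∈ D, q ∉ C → g q = 0) (q : X) (hq : q ∉ C) : D.indicator g =ᶠ[𝓝 q] fun _ => 0 := by
  filter_upwards [hC.isOpen_compl.mem_nhds hq] with y hy
  by_cases hyD : y ∈ D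
  · rw [Set.indicator_of_mem hyD, h0 y hyD hy]
  · rw [Set.indicator_of_notMem hyD]

lemma glue_cont {X : Type*} [TopologicalSpace X] {D C : Set X} (hDo : IsOpen D) (hC : IsClosed C)
    (hCD : C ⊆ D) (g : X → ℝ) (hg : ContinuousOn g D) (h0 : ∀ q ∈ D, q ∉ C → g q = 0) :
    Continuous (D.indicator g) := by
  rw [continuous_iff_continuousAt]
  intro q
  by_cases hq : q ∈ D
  · refine (hg.continuousAt (hDo.mem_nhds hq)).congr ?_
    filter_upwards [hDo.mem_nhds hq] with y hy
    rw [Set.indicator_of_mem hy]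
  · exact continuousAt_const.congr (glue_zero hC g h0 q (fun h => hq (hCD h))).symm

lemma glue_deriv {X : Type*} [TopologicalSpace X] {D C : Set X} (hDo : IsOpen D) (hC : IsClosed C)
    (hCD : C ⊆ D) (g g' : X → ℝ) (h0 : ∀ q ∈ D, q ∉ C → g q = 0)
    (c : ℝ → X) (hc : Continuous c) (r : ℝ)
    (h : c r ∈ D → HasDerivAt (fun r => g (c r)) (g' (c r)) r) :
    HasDerivAt (fun r => D.indicator g (c r)) (D.indicator g' (c r)) r := by
  by_cases hq : c r ∈ D
  · rw [Set.indicator_of_mem hq]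
    refine (h hq).congr_of_eventuallyEq ?_
    filter_upwards [hc.continuousAt (hDo.mem_nhds hq)] with y hy
    exact Set.indicator_of_mem (show c y ∈ D from hy) g
  · rw [Set.indicator_of_notMem hq]
    refine (hasDerivAt_const r (0 : ℝ)).congr_of_eventuallyEq ?_
    exact hc.continuousAt (glue_zero hC g h0 (c r) (fun h => hq (hCD h)))

lemma cutoff_construction (T δ : ℝ) (hδ : 0 < δ) (s s1 : ℝ → ℝ) (hs : Continuous s)
    (hs1 : ∀ t ∈ Set.Ioo 0 T, HasDerivAt s (s1 t) t) (hs1c : ContinuousOn s1 (Set.Ioo 0 T))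
    (D C : Set (ℝ × ℝ))
    (hD : D = {p : ℝ × ℝ | 0 < p.1 ∧ p.1 < s p.2 ∧ 0 < p.2 ∧ p.2 < T})
    (hC : C = {p : ℝ × ℝ | δ ≤ p.1 ∧ δ ≤ s p.2 - p.1 ∧ δ ≤ p.2 ∧ δ ≤ T - p.2})
    (u ux uxx ut : ℝ × ℝ → ℝ)
    (hu_cont : ContinuousOn u D)
    (hux : ∀ p ∈ D, HasDerivAt (fun x => u (x, p.2)) (ux p) p.1)
    (huxx : ∀ p ∈ D, HasDerivAt (fun x => ux (x, p.2)) (uxx p) p.1)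
    (hut : ∀ p ∈ D, HasDerivAt (fun t => u (p.1, t)) (ut p) p.2)
    (hux_cont : ContinuousOn ux D)
    (huxx_cont : ContinuousOn uxx D)
    (hut_cont : ContinuousOn ut D)
    (heq : ∀ p ∈ D, uxx p = ut p) :
    ∃ v vx vxx vt : ℝ × ℝ → ℝ, Continuous v ∧ Continuous vx ∧ Continuous vxx ∧ Continuous vt ∧
      (∀ q, q ∉ C → v q = 0 ∧ vx q = 0 ∧ vxx q = 0 ∧ vt q = 0) ∧
      (∀ p : ℝ × ℝ, HasDerivAt (fun x => v (x, p.2)) (vx p) p.1) ∧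
      (∀ p : ℝ × ℝ, HasDerivAt (fun x => vx (x, p.2)) (vxx p) p.1) ∧
      (∀ p : ℝ × ℝ, HasDerivAt (fun t => v (p.1, t)) (vt p) p.2) ∧
      (∀ q : ℝ × ℝ, 2 * δ ≤ q.1 → 2 * δ ≤ s q.2 - q.1 → 2 * δ ≤ q.2 → 2 * δ ≤ T - q.2 → v q = u q) ∧
      (∀ q : ℝ × ℝ, 2 * δ < q.1 → 2 * δ < s q.2 - q.1 → 2 * δ < q.2 → 2 * δ < T - q.2 →
        vt q - vxx q = 0) := by
  obtain ⟨α, α1, α2, ca, ca1, ca2, da, da1, az, ao, ao1⟩ := cutoff_fun δ hδ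
  have hDo : IsOpen D := by
    rw [hD]
    simp only [Set.ofPred_and]
    refine IsOpen.inter ?_ (IsOpen.inter ?_ (IsOpen.inter ?_ ?_)) <;>
      exact isOpen_lt (by fun_prop) (by fun_prop)
  have hCc : IsClosed C := by
    rw [hC]
    simp only [Set.ofPred_and]
    refine IsClosed.inter ?_ (IsClosed.inter ?_ (IsClosed.inter ?_ ?_)) <;>
      exact isClosed_le (by fun_prop) (by fun_prop)
  have hCD : C ⊆ D := by
    rw [hC, hD]
    rintro q ⟨h1, h2, h3, h4⟩
    exact ⟨by linarith, by linarith, by linarith, by linarith⟩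
  have hDt : ∀ q ∈ D, q.2 ∈ Set.Ioo 0 T := by
    rw [hD]; intro q hq; exact ⟨hq.2.2.1, hq.2.2.2⟩
  have hs1c' : ContinuousOn (fun q : ℝ × ℝ => s1 q.2) D := hs1c.comp continuousOn_snd hDt
  have hnC : ∀ q, q ∉ C → q.1 < δ ∨ s q.2 - q.1 < δ ∨ q.2 < δ ∨ T - q.2 < δ := by
    intro q hq
    by_contra hcon
    push Not at hcon
    exact hq (by rw [hC]; exact hcon)
  obtain ⟨m, hm⟩ : ∃ m : ℝ → ℝ, m = fun t => α t * α (T - t) := ⟨_, rfl⟩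
  obtain ⟨m1, hm1⟩ : ∃ m1 : ℝ → ℝ, m1 = fun t => α1 t * α (T - t) - α t * α1 (T - t) := ⟨_, rfl⟩
  have cm : Continuous m := by rw [hm]; fun_prop
  have cm1 : Continuous m1 := by rw [hm1]; fun_prop
  have dm : ∀ t, HasDerivAt m (m1 t) t := by
    intro t
    have e : HasDerivAt (fun t => α (T - t)) (α1 (T - t) * (-1)) t :=
      (da (T - t)).comp t (by simpa using (hasDerivAt_id t).const_sub T)
    rw [hm, hm1]
    exact ((da t).mul e).congr_deriv (by ring)
  have mz : ∀ t, t < δ ∨ T - t < δ → m t = 0 ∧ m1 t = 0 := by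
    rw [hm, hm1]
    rintro t (h | h)
    · simp [az _ h]
    · simp [az _ h]
  obtain ⟨φ, hφ⟩ : ∃ φ : ℝ × ℝ → ℝ, φ = fun q => α q.1 * α (s q.2 - q.1) * m q.2 := ⟨_, rfl⟩
  obtain ⟨φx, hφx⟩ : ∃ φx : ℝ × ℝ → ℝ, φx = fun q =>
    (α1 q.1 * α (s q.2 - q.1) - α q.1 * α1 (s q.2 - q.1)) * m q.2 := ⟨_, rfl⟩
  obtain ⟨φxx, hφxx⟩ : ∃ φxx : ℝ × ℝ → ℝ, φxx = fun q =>
    (α2 q.1 * α (s q.2 - q.1) - 2 * (α1 q.1 * α1 (s q.2 - q.1)) + α q.1 * α2 (s q.2 - q.1)) * m q.2 :=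
    ⟨_, rfl⟩
  obtain ⟨φt, hφt⟩ : ∃ φt : ℝ × ℝ → ℝ, φt = fun q =>
    α q.1 * (α1 (s q.2 - q.1) * s1 q.2 * m q.2 + α (s q.2 - q.1) * m1 q.2) := ⟨_, rfl⟩
  have cφ : Continuous φ := by rw [hφ]; fun_prop
  have cφx : Continuous φx := by rw [hφx]; fun_prop
  have cφxx : Continuous φxx := by rw [hφxx]; fun_prop
  have cφt : ContinuousOn φt D := by
    rw [hφt]
    have c1 : Continuous (fun q : ℝ × ℝ => α1 (s q.2 - q.1)) := by fun_prop
    have c2 : Continuous (fun q : ℝ × ℝ => α q.1) := by fun_prop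
    have c3 : Continuous (fun q : ℝ × ℝ => m q.2) := by fun_prop
    have c4 : Continuous (fun q : ℝ × ℝ => α (s q.2 - q.1) * m1 q.2) := by fun_prop
    exact c2.continuousOn.mul (((c1.continuousOn.mul hs1c').mul c3.continuousOn).add c4.continuousOn)
  have zφ : ∀ q, q ∉ C → φ q = 0 ∧ φx q = 0 ∧ φxx q = 0 ∧ φt q = 0 := by
    intro q hq
    rw [hφ, hφx, hφxx, hφt]
    rcases hnC q hq with h | h | h | h
    · simp [az _ h]
    · simp [az _ h]
    · simp [mz _ (Or.inl h)]
    · simp [mz _ (Or.inr h)]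
  have ex : ∀ q : ℝ × ℝ, HasDerivAt (fun x => s q.2 - x) (-1) q.1 := fun q => by
    simpa using (hasDerivAt_id q.1).const_sub (s q.2)
  have dφx : ∀ q : ℝ × ℝ, HasDerivAt (fun x => φ (x, q.2)) (φx q) q.1 := by
    intro q
    rw [hφ, hφx]
    have e : HasDerivAt (fun x => α (s q.2 - x)) (α1 (s q.2 - q.1) * (-1)) q.1 :=
      (da _).comp q.1 (ex q)
    exact (((da q.1).mul e).mul_const (m q.2)).congr_deriv (by ring)
  have dφxx : ∀ q : ℝ × ℝ, HasDerivAt (fun x => φx (x, q.2)) (φxx q) q.1 := by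
    intro q
    rw [hφx, hφxx]
    have e : HasDerivAt (fun x => α (s q.2 - x)) (α1 (s q.2 - q.1) * (-1)) q.1 :=
      (da _).comp q.1 (ex q)
    have e1 : HasDerivAt (fun x => α1 (s q.2 - x)) (α2 (s q.2 - q.1) * (-1)) q.1 :=
      (da1 _).comp q.1 (ex q)
    exact ((((da1 q.1).mul e).sub ((da q.1).mul e1)).mul_const (m q.2)).congr_deriv (by ring)
  have dφt : ∀ q ∈ D, HasDerivAt (fun t => φ (q.1, t)) (φt q) q.2 := by
    intro q hq
    rw [hφ, hφt]
    have e0 : HasDerivAt (fun t => s t - q.1) (s1 q.2) q.2 := (hs1 q.2 (hDt q hq)).sub_const q.1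
    have e : HasDerivAt (fun t => α (s t - q.1)) (α1 (s q.2 - q.1) * s1 q.2) q.2 :=
      HasDerivAt.comp (h₂ := α) q.2 (da _) e0
    exact ((e.const_mul (α q.1)).mul (dm q.2)).congr_deriv (by ring)
  have h0 : ∀ q ∈ D, q ∉ C → φ q * u q = 0 := fun q _ hq => by simp [zφ q hq]
  have hx0 : ∀ q ∈ D, q ∉ C → φx q * u q + φ q * ux q = 0 := fun q _ hq => by simp [zφ q hq]
  have hxx0 : ∀ q ∈ D, q ∉ C → φxx q * u q + 2 * (φx q * ux q) + φ q * uxx q = 0 :=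
    fun q _ hq => by simp [zφ q hq]
  have ht0 : ∀ q ∈ D, q ∉ C → φt q * u q + φ q * ut q = 0 := fun q _ hq => by simp [zφ q hq]
  refine ⟨D.indicator fun q => φ q * u q, D.indicator fun q => φx q * u q + φ q * ux q,
    D.indicator fun q => φxx q * u q + 2 * (φx q * ux q) + φ q * uxx q,
    D.indicator fun q => φt q * u q + φ q * ut q, ?_, ?_, ?_, ?_, ?_, ?_, ?_, ?_, ?_, ?_⟩
  · exact glue_cont hDo hCc hCD _ (cφ.continuousOn.mul hu_cont) h0
  · exact glue_cont hDo hCc hCD _ ((cφx.continuousOn.mul hu_cont).add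
      (cφ.continuousOn.mul hux_cont)) hx0
  · exact glue_cont hDo hCc hCD _ (((cφxx.continuousOn.mul hu_cont).add
      (continuousOn_const.mul (cφx.continuousOn.mul hux_cont))).add
      (cφ.continuousOn.mul huxx_cont)) hxx0
  · exact glue_cont hDo hCc hCD _ ((cφt.mul hu_cont).add (cφ.continuousOn.mul hut_cont)) ht0
  · intro q hq
    exact ⟨(glue_zero hCc _ h0 q hq).self_of_nhds, (glue_zero hCc _ hx0 q hq).self_of_nhds,
      (glue_zero hCc _ hxx0 q hq).self_of_nhds, (glue_zero hCc _ ht0 q hq).self_of_nhds⟩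
  · intro p
    exact glue_deriv hDo hCc hCD _ _ h0 (fun x => (x, p.2)) (by fun_prop) p.1
      (fun hp => (dφx p).mul (hux p hp))
  · intro p
    exact glue_deriv hDo hCc hCD _ (fun q => φxx q * u q + 2 * (φx q * ux q) + φ q * uxx q) hx0 (fun x => (x, p.2)) (by fun_prop) p.1
      (fun hp => (((dφxx p).mul (hux p hp)).add ((dφx p).mul (huxx p hp))).congr_deriv (by
        simp only [Prod.mk.eta]; ring))
  · intro p
    exact glue_deriv hDo hCc hCD _ _ h0 (fun t => (p.1, t)) (by fun_prop) p.2
      (fun hp => (dφt p hp).mul (hut p hp))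
  · intro q h1 h2 h3 h4
    have hqD : q ∈ D := by
      rw [hD]; exact ⟨by linarith, by linarith, by linarith, by linarith⟩
    rw [Set.indicator_of_mem hqD, hφ, hm]
    simp only [ao _ h1, ao _ h2, ao _ h3, ao _ h4, one_mul]
  · intro q h1 h2 h3 h4
    have hqD : q ∈ D := by
      rw [hD]; exact ⟨by linarith, by linarith, by linarith, by linarith⟩
    rw [Set.indicator_of_mem hqD, Set.indicator_of_mem hqD, hφ, hφt, hφxx, hφx, hm, hm1]
    simp [ao _ h1.le, ao _ h2.le, ao _ h3.le, ao _ h4.le, ao1 _ h1, ao1 _ h2, ao1 _ h3, ao1 _ h4,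
      heq q hqD]


lemma core_ker {K : Set (ℝ × ℝ)} (hKc : IsCompact K) [CompactSpace K] {E : Type*}
    [NormedAddCommGroup E]
    [NormedSpace ℂ E] [CompleteSpace E] (l : C(K, ℂ) →L[ℂ] E) (hl : ∀ n, l (hpMap K n) = 0)
    (v vx vxx vt : ℝ × ℝ → ℝ) (hv : Continuous v) (hvx : Continuous vx)
    (hvxx : Continuous vxx) (hvt : Continuous vt) (C : Set (ℝ × ℝ)) (hC : IsCompact C)
    (hR : ∀ q, q ∉ C → v q = 0 ∧ vx q = 0 ∧ vxx q = 0 ∧ vt q = 0)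
    (dx : ∀ p : ℝ × ℝ, HasDerivAt (fun x => v (x, p.2)) (vx p) p.1)
    (dxx : ∀ p : ℝ × ℝ, HasDerivAt (fun x => vx (x, p.2)) (vxx p) p.1)
    (dt : ∀ p : ℝ × ℝ, HasDerivAt (fun t => v (p.1, t)) (vt p) p.2)
    (hnear : ∀ p ∈ K, ∀ᶠ q in 𝓝 p, vt q - vxx q = 0)
    (hray : ∀ q, vt q - vxx q ≠ 0 → ∃ sg : ℝ, (sg = 1 ∨ sg = -1) ∧
      ∀ r, 0 ≤ r → (q.1 + sg * r, q.2) ∉ K)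
    (U : C(K, ℂ)) (hU : ∀ p : K, U p = (v p.1 : ℂ)) : l U = 0 := by
  obtain ⟨f, hf⟩ : ∃ f : ℝ × ℝ → ℝ, f = fun q => vt q - vxx q := ⟨_, rfl⟩
  have cf : Continuous f := by rw [hf]; fun_prop
  have fz : ∀ q, q ∉ C → f q = 0 := fun q hq => by rw [hf]; simp [hR q hq]
  have hcont : Continuous (fun z : (ℝ × ℝ) × K =>
      ((f z.1 * hk (z.2.1.1 - z.1.1) (z.2.1.2 - z.1.2) : ℝ) : ℂ)) := by
    refine Complex.continuous_ofReal.comp ?_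
    rw [continuous_iff_continuousAt]
    rintro ⟨q, p⟩
    by_cases hqp : q = p.1
    · have h1 : ∀ᶠ z : (ℝ × ℝ) × K in 𝓝 (q, p), f z.1 = 0 := by
        have := hnear p.1 p.2
        rw [← hqp] at this
        have h2 : Tendsto (fun z : (ℝ × ℝ) × K => z.1) (𝓝 (q, p)) (𝓝 q) := continuous_fst.tendsto _
        rw [hf]
        exact h2.eventually this
      refine (continuousAt_const (y := (0 : ℝ))).congr ?_
      filter_upwards [h1] with z hz
      rw [hz, zero_mul]
    · refine (cf.comp continuous_fst).continuousAt.mul ?_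
      have h3 : p.1.2 - q.2 ≠ 0 ∨ p.1.1 - q.1 ≠ 0 := by
        by_contra hcon
        push Not at hcon
        exact hqp (Prod.ext (sub_eq_zero.1 hcon.2).symm (sub_eq_zero.1 hcon.1).symm)
      exact ContinuousAt.comp (f := fun z : (ℝ × ℝ) × K => (z.2.1.1 - z.1.1, z.2.1.2 - z.1.2))
        (x := (q, p)) (hk_continuousAt (p.1.1 - q.1) (p.1.2 - q.2) h3) (by fun_prop)
  obtain ⟨H, hHc, hH⟩ : ∃ H : ℝ × ℝ → C(K, ℂ), Continuous H ∧
      ∀ q p, H q p = ((f q * hk (p.1.1 - q.1) (p.1.2 - q.2) : ℝ) : ℂ) :=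
    ⟨(ContinuousMap.curry ⟨_, hcont⟩), ContinuousMap.continuous _, fun q p => rfl⟩
  have hHi : Integrable H := by
    refine hHc.integrable_of_hasCompactSupport (HasCompactSupport.intro hC ?_)
    intro q hq
    ext p
    rw [hH, fz q hq]; simp
  have hlH : ∀ q, l (H q) = 0 := by
    intro q
    by_cases hq : f q = 0
    · have : H q = 0 := by
        ext p; rw [hH, hq]; simp
      rw [this, map_zero]
    · have hq' := hq
      rw [hf] at hq'
      obtain ⟨sg, hsg, hr⟩ := hray q hq'
      have hqK : q ∉ K := by simpa using hr 0 le_rfl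
      have e : H q = (f q : ℂ) • kern K (q.1 : ℂ) q.2 := by
        ext p
        rw [hH, ContinuousMap.smul_apply, kern_apply]
        · rw [← Complex.ofReal_sub, hkC_ofReal]; simp
        · intro p hp
          by_contra hcon
          push Not at hcon
          have h2 : ((((p.1 : ℂ) - q.1) ^ 2)).re = (p.1 - q.1) ^ 2 := by
            rw [← Complex.ofReal_sub, ← Complex.ofReal_pow, Complex.ofReal_re]
          rw [h2] at hcon
          have h3 : p.1 - q.1 = 0 := by
            have := sq_nonneg (p.1 - q.1)
            exact pow_eq_zero_iff (two_ne_zero) |>.1 (le_antisymm hcon.2 this)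
          exact hqK ((Prod.ext (sub_eq_zero.1 h3) (sub_eq_zero.1 hcon.1) : p = q) ▸ hp)
      rw [e, map_smul, push_ker hKc l hl sg q.1 q.2 hsg hr, smul_zero]
  have hint0 : l (∫ q, H q) = 0 := by
    rw [← ContinuousLinearMap.integral_comp_comm l hHi]
    simp [hlH]
  obtain ⟨R, hRb⟩ := hC.isBounded.exists_norm_le
  have hval : ∫ q, H q = ((√(4 * Real.pi) : ℝ) : ℂ) • U := by
    ext p
    have h1 := ContinuousLinearMap.integral_comp_comm (ContinuousMap.evalCLM (α := K) (M := ℂ) ℂ p) hHi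
    have h2 : Integrable (fun q => H q p) :=
      (ContinuousMap.evalCLM (α := K) (M := ℂ) ℂ p).integrable_comp hHi
    have h3 : Integrable (fun q : ℝ × ℝ => (vt q - vxx q) * hk (p.1.1 - q.1) (p.1.2 - q.2)) := by
      refine h2.re.congr (Eventually.of_forall fun q => ?_)
      simp only [hH, hf]
      exact Complex.ofReal_re _
    have h4 := representation v vx vxx vt hv hvx hvxx hvt R
      (fun q hq => hR q (fun hqC => absurd (hRb q hqC) (not_le.2 (lt_of_lt_of_le hq (norm_fst_le q)))))
      (fun q hq => (hR q (fun hqC =>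
        absurd (hRb q hqC) (not_le.2 (lt_of_lt_of_le hq (norm_snd_le q))))).1)
      dx dxx dt p.1.1 p.1.2 h3
    have h5 : (∫ q, H q) p = ∫ q, H q p := h1.symm
    rw [h5]
    simp only [hH]
    rw [integral_complex_ofReal]
    simp only [hf]
    rw [h4, ContinuousMap.smul_apply, hU]
    simp
  rw [hval, map_smul] at hint0
  refine (smul_eq_zero.1 hint0).resolve_left ?_
  have : 0 < √(4 * Real.pi) := by positivity
  exact_mod_cast this.ne'

lemma approx_of_ker {K : Set (ℝ × ℝ)} (hKc : IsCompact K) [CompactSpace K] (U : C(K, ℂ))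
    (w : ℝ × ℝ → ℝ) (hU : ∀ p : K, U p = (w p.1 : ℂ))
    (h : ∀ (S : Submodule ℂ C(K, ℂ)), IsClosed (S : Set C(K, ℂ)) → (∀ n, hpMap K n ∈ S) → U ∈ S)
    (ε : ℝ) (hε : 0 < ε) :
    ∃ (N : ℕ) (a : ℕ → ℝ), ∀ p ∈ K,
      |w p - ∑ n ∈ Finset.range (N + 1), a n * heatPoly n p.1 p.2| < ε := by
  have h1 := h (Submodule.span ℂ (Set.range (hpMap K))).topologicalClosure
    (Submodule.isClosed_topologicalClosure _)
    (fun n => Submodule.le_topologicalClosure _ (Submodule.subset_span ⟨n, rfl⟩))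
  have h2 : U ∈ closure ((Submodule.span ℂ (Set.range (hpMap K)) : Submodule ℂ C(K, ℂ)) : Set C(K, ℂ)) := h1
  obtain ⟨g, hg, hgU⟩ := Metric.mem_closure_iff.1 h2 ε hε
  obtain ⟨c, hc⟩ := Finsupp.mem_span_range_iff_exists_finsupp.1 hg
  refine ⟨c.support.sup id, fun n => (c n).re, fun p hp => ?_⟩
  have h3 : g ⟨p, hp⟩ = ∑ n ∈ Finset.range (c.support.sup id + 1), c n * (heatPoly n p.1 p.2 : ℂ) := by
    rw [← hc, Finsupp.sum_of_support_subset c (s := Finset.range (c.support.sup id + 1)) ?_ _ (by simp)]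
    · rw [ContinuousMap.sum_apply]
      rfl
    · intro n hn
      exact Finset.mem_range.2 (Nat.lt_succ_of_le (Finset.le_sup (f := id) hn))
  have h4 : dist (U ⟨p, hp⟩) (g ⟨p, hp⟩) < ε := lt_of_le_of_lt (ContinuousMap.dist_apply_le_dist _) hgU
  rw [dist_eq_norm, hU, h3] at h4
  refine lt_of_le_of_lt (le_of_eq_of_le ?_ (Complex.abs_re_le_norm _)) h4
  simp [Complex.re_sum]

lemma main_aux (T L : ℝ) (s s1 : ℝ → ℝ) (hs : Continuous s)
    (hs1 : ∀ t ∈ Set.Ioo 0 T, HasDerivAt s (s1 t) t) (hs1c : ContinuousOn s1 (Set.Ioo 0 T))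
    (hsL : ∀ t ∈ Set.Ioo 0 T, s t ≤ L)
    (D : Set (ℝ × ℝ))
    (hD : D = {p : ℝ × ℝ | 0 < p.1 ∧ p.1 < s p.2 ∧ 0 < p.2 ∧ p.2 < T})
    (u ux uxx ut : ℝ × ℝ → ℝ)
    (hu_cont : ContinuousOn u D)
    (hux : ∀ p ∈ D, HasDerivAt (fun x => u (x, p.2)) (ux p) p.1)
    (huxx : ∀ p ∈ D, HasDerivAt (fun x => ux (x, p.2)) (uxx p) p.1)
    (hut : ∀ p ∈ D, HasDerivAt (fun t => u (p.1, t)) (ut p) p.2)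
    (hux_cont : ContinuousOn ux D)
    (huxx_cont : ContinuousOn uxx D)
    (hut_cont : ContinuousOn ut D)
    (heq : ∀ p ∈ D, uxx p = ut p) (Dc : Set (ℝ × ℝ)) (hDc : IsCompact Dc) (hDcD : Dc ⊆ D)
    (ε : ℝ) (hε : 0 < ε) :
    ∃ (N : ℕ) (a : ℕ → ℝ), ∀ p ∈ Dc,
      |u p - ∑ n ∈ Finset.range (N + 1), a n * heatPoly n p.1 p.2| < ε := by
  obtain ⟨B, hB⟩ : ∃ B : ℝ → Set (ℝ × ℝ), B = fun c =>
    {p : ℝ × ℝ | c ≤ p.1 ∧ c ≤ s p.2 - p.1 ∧ c ≤ p.2 ∧ c ≤ T - p.2} := ⟨_, rfl⟩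
  have hBmem : ∀ c p, p ∈ B c ↔ c ≤ p.1 ∧ c ≤ s p.2 - p.1 ∧ c ≤ p.2 ∧ c ≤ T - p.2 := by
    intro c p; rw [hB]; rfl
  have hBc : ∀ c, 0 < c → IsCompact (B c) := by
    intro c hc
    refine IsCompact.of_isClosed_subset
      ((isCompact_Icc (a := (0 : ℝ)) (b := L)).prod (isCompact_Icc (a := (0 : ℝ)) (b := T))) ?_ ?_
    · rw [hB]
      simp only [Set.ofPred_and]
      refine IsClosed.inter ?_ (IsClosed.inter ?_ (IsClosed.inter ?_ ?_)) <;>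
        exact isClosed_le (by fun_prop) (by fun_prop)
    · intro p hp
      obtain ⟨h1, h2, h3, h4⟩ := (hBmem c p).1 hp
      have := hsL p.2 ⟨by linarith, by linarith⟩
      exact ⟨⟨by linarith, by linarith⟩, ⟨by linarith, by linarith⟩⟩
  obtain ⟨δ, hδ, hsub⟩ : ∃ δ, 0 < δ ∧ Dc ⊆ B (3 * δ) := by
    have hmc : Continuous (fun p : ℝ × ℝ => min (min p.1 (s p.2 - p.1)) (min p.2 (T - p.2))) := by
      fun_prop
    rcases Dc.eq_empty_or_nonempty with h | h
    · exact ⟨1, one_pos, by rw [h]; exact Set.empty_subset _⟩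
    · obtain ⟨p0, hp0, hmin⟩ := hDc.exists_isMinOn h hmc.continuousOn
      have hp0D := hDcD hp0
      rw [hD] at hp0D
      obtain ⟨g1, g2, g3, g4⟩ := hp0D
      refine ⟨min (min p0.1 (s p0.2 - p0.1)) (min p0.2 (T - p0.2)) / 3, ?_, ?_⟩
      · have : 0 < min (min p0.1 (s p0.2 - p0.1)) (min p0.2 (T - p0.2)) :=
          lt_min (lt_min g1 (by linarith)) (lt_min g3 (by linarith))
        positivity
      · intro p hp
        have := hmin hp
        simp only [Set.mem_setOf_eq] at this
        rw [hBmem, mul_div_cancel₀ _ (by norm_num : (3 : ℝ) ≠ 0)]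
        have h5 := le_min_iff.1 this
        have h6 := le_min_iff.1 h5.1
        have h7 := le_min_iff.1 h5.2
        exact ⟨h6.1, h6.2, h7.1, h7.2⟩
  obtain ⟨v, vx, vxx, vt, cv, cvx, cvxx, cvt, hz, dx, dxx, dt, hvu, hf0⟩ :=
    cutoff_construction T δ hδ s s1 hs hs1 hs1c D (B δ) hD (by rw [hB]) u ux uxx ut hu_cont
      hux huxx hut hux_cont huxx_cont hut_cont heq
  have hKc := hBc (3 * δ) (by positivity)
  have : CompactSpace (B (3 * δ)) := isCompact_iff_compactSpace.1 hKc
  obtain ⟨U, hU⟩ : ∃ U : C(B (3 * δ), ℂ), ∀ p, U p = (v p.1 : ℂ) :=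
    ⟨⟨fun p => (v p.1 : ℂ), by fun_prop⟩, fun p => rfl⟩
  obtain ⟨N, a, ha⟩ := approx_of_ker hKc U v hU (by
    intro S hS hSn
    have : IsClosed (S : Set C(B (3 * δ), ℂ)) := hS
    have hk0 := core_ker hKc (S.mkQL) (fun n => (Submodule.Quotient.mk_eq_zero S).2 (hSn n))
      v vx vxx vt cv cvx cvxx cvt (B δ) (hBc δ hδ) hz dx dxx dt ?_ ?_ U hU
    · exact (Submodule.Quotient.mk_eq_zero S).1 hk0
    · intro p hp
      obtain ⟨h1, h2, h3, h4⟩ := (hBmem _ p).1 hp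
      have e1 : ∀ᶠ q : ℝ × ℝ in 𝓝 p, 2 * δ < q.1 :=
        (continuous_fst.tendsto p).eventually (lt_mem_nhds (by linarith))
      have e2 : ∀ᶠ q : ℝ × ℝ in 𝓝 p, 2 * δ < s q.2 - q.1 :=
        ((by fun_prop : Continuous fun q : ℝ × ℝ => s q.2 - q.1).tendsto p).eventually
          (lt_mem_nhds (by linarith))
      have e3 : ∀ᶠ q : ℝ × ℝ in 𝓝 p, 2 * δ < q.2 :=
        (continuous_snd.tendsto p).eventually (lt_mem_nhds (by linarith))
      have e4 : ∀ᶠ q : ℝ × ℝ in 𝓝 p, 2 * δ < T - q.2 :=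
        ((by fun_prop : Continuous fun q : ℝ × ℝ => T - q.2).tendsto p).eventually
          (lt_mem_nhds (by linarith))
      filter_upwards [e1, e2, e3, e4] with q q1 q2 q3 q4 using hf0 q q1 q2 q3 q4
    · intro q hq
      by_cases h1 : 2 * δ < q.1
      · refine ⟨1, Or.inl rfl, fun r hr hmem => hq ?_⟩
        obtain ⟨g1, g2, g3, g4⟩ := (hBmem _ _).1 hmem
        simp only at g1 g2 g3 g4
        exact hf0 q h1 (by linarith) (by linarith) (by linarith)
      · refine ⟨-1, Or.inr rfl, fun r hr hmem => ?_⟩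
        obtain ⟨g1, g2, g3, g4⟩ := (hBmem _ _).1 hmem
        simp only at g1 g2 g3 g4
        linarith) ε hε
  refine ⟨N, a, fun p hp => ?_⟩
  have h1 := ha p (hsub hp)
  obtain ⟨g1, g2, g3, g4⟩ := (hBmem _ p).1 (hsub hp)
  rwa [hvu p (by linarith) (by linarith) (by linarith) (by linarith)] at h1


end HeatAux

/-- Completeness of the heat polynomials: any classical solution of the heat
equation `u_xx = u_t` in `D(s)`, continuous on the closure of `D(s)`, can be
uniformly approximated on every compact subset of `D(s)` by finite linear
combinations `Σ_{n=0}^N a_n h_n`. -/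
theorem heatPolys_complete (T L : ℝ) (hT : 0 < T) (hL : 0 < L)
    (s : ℝ → ℝ) (hs : ContDiffOn ℝ 1 s (Set.Icc 0 T))
    (hs_pos : ∀ t ∈ Set.Ico (0 : ℝ) T, 0 < s t ∧ s t ≤ L)
    (D : Set (ℝ × ℝ))
    (hD : D = {p : ℝ × ℝ | 0 < p.1 ∧ p.1 < s p.2 ∧ 0 < p.2 ∧ p.2 < T})
    (u ux uxx ut : ℝ × ℝ → ℝ)
    (hu_cont : ContinuousOn u (closure D))
    (hux : ∀ p ∈ D, HasDerivAt (fun x => u (x, p.2)) (ux p) p.1)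
    (huxx : ∀ p ∈ D, HasDerivAt (fun x => ux (x, p.2)) (uxx p) p.1)
    (hut : ∀ p ∈ D, HasDerivAt (fun t => u (p.1, t)) (ut p) p.2)
    (hux_cont : ContinuousOn ux D)
    (huxx_cont : ContinuousOn uxx D)
    (hut_cont : ContinuousOn ut D)
    (heq : ∀ p ∈ D, uxx p = ut p) :
    ∀ Dc : Set (ℝ × ℝ), IsCompact Dc → Dc ⊆ D →
      ∀ ε : ℝ, 0 < ε →
        ∃ (N : ℕ) (a : ℕ → ℝ), ∀ p ∈ Dc,
          |u p - ∑ n ∈ Finset.range (N + 1), a n * heatPoly n p.1 p.2| < ε := by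
  intro Dc hDc hDcD ε hε
  have hpc : Continuous (fun t : ℝ => max 0 (min t T)) := by fun_prop
  have hpm : ∀ t : ℝ, max 0 (min t T) ∈ Set.Icc (0 : ℝ) T := fun t =>
    ⟨le_max_left _ _, max_le hT.le (min_le_right _ _)⟩
  have hpe : ∀ t ∈ Set.Ioo (0 : ℝ) T, max 0 (min t T) = t := by
    intro t ht
    rw [min_eq_left ht.2.le, max_eq_right ht.1.le]
  have hD' : D = {p : ℝ × ℝ | 0 < p.1 ∧ p.1 < s (max 0 (min p.2 T)) ∧ 0 < p.2 ∧ p.2 < T} := by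
    rw [hD]
    ext p
    constructor
    · rintro ⟨h1, h2, h3, h4⟩
      exact ⟨h1, by rw [hpe p.2 ⟨h3, h4⟩]; exact h2, h3, h4⟩
    · rintro ⟨h1, h2, h3, h4⟩
      exact ⟨h1, by rw [hpe p.2 ⟨h3, h4⟩] at h2; exact h2, h3, h4⟩
  have hso : ContDiffOn ℝ 1 s (Set.Ioo 0 T) := hs.mono Set.Ioo_subset_Icc_self
  refine main_aux T L (fun t => s (max 0 (min t T))) (deriv s)
    (hs.continuousOn.comp_continuous hpc hpm) ?_
    (hso.continuousOn_deriv_of_isOpen isOpen_Ioo le_rfl) ?_ D hD' u ux uxx ut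
    (hu_cont.mono subset_closure) hux huxx hut hux_cont huxx_cont hut_cont heq Dc hDc hDcD ε hε
  · intro t ht
    have h1 : HasDerivAt s (deriv s t) t :=
      ((hso.differentiableOn one_ne_zero).differentiableAt (isOpen_Ioo.mem_nhds ht)).hasDerivAt
    refine h1.congr_of_eventuallyEq ?_
    filter_upwards [isOpen_Ioo.mem_nhds ht] with y hy
    rw [hpe y hy]
  · intro t ht
    simp only [hpe t ht]
    exact (hs_pos t ⟨ht.1.le, ht.2⟩).2
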